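/- For every simple rectilinear polygon Q (with vertex classes V_0=Ver_0(Q), V_1=Ver_1(Q) alternating along the boundary, distinct x-coordinates of vertical edges and distinct y-coordinates of horizontal edges), there exists a sequence of rectangle transformations transforming Ver_0(Q) into Ver_1(Q) whose rectangles R_1,…,R_k have pairwise disjoint interiors, are all contained in the region bounded by Q, and satisfy ∑_j Area(R_j) = Area(Q), the area of the region bounded by Q. -/

import Mathlib

/-- The closed axis-parallel rectangle with diagonal vertices `v` and `w`. -/
def rect (v w : ℝ × ℝ) : Set (ℝ × ℝ) :=
  Set.Icc (min v.1 w.1) (max v.1 w.1) ×ˢ Set.Icc (min v.2 w.2) (max v.2 w.2)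

/-- The cyclically next index. -/
def nextIdx {m : ℕ} (i : Fin m) : Fin m := ⟨((i : ℕ) + 1) % m, Nat.mod_lt _ i.pos⟩

/-- The boundary curve of the polygon with cyclic vertex sequence `v`. -/
def polyBoundary {m : ℕ} (v : Fin m → ℝ × ℝ) : Set (ℝ × ℝ) :=
  ⋃ i, segment ℝ (v i) (v (nextIdx i))

/-- The closed region bounded by a curve `B`: the curve together with all points
whose connected component in the complement of `B` is bounded. -/
def boundedRegion (B : Set (ℝ × ℝ)) : Set (ℝ × ℝ) :=
  B ∪ {p | Bornology.IsBounded (connectedComponentIn Bᶜ p)}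

/-- A simple rectilinear polygon with `2n` vertices, listed cyclically; the
even-indexed vertices are the initial vertices (`V₀`), the odd-indexed ones the
terminal vertices (`V₁`).  Edges starting at even indices are horizontal, edges
starting at odd indices are vertical; horizontal edges have pairwise distinct
y-coordinates and vertical edges pairwise distinct x-coordinates; and the closed
curve is simple (non-adjacent edges are disjoint, adjacent edges meet only in
their common vertex). -/
def IsSimpleRectPolygon (n : ℕ) (v : Fin (2 * n) → ℝ × ℝ) : Prop :=
  0 < n ∧
  (∀ i : Fin (2 * n), (i : ℕ) % 2 = 0 →
    (v (nextIdx i)).2 = (v i).2 ∧ (v (nextIdx i)).1 ≠ (v i).1) ∧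
  (∀ i : Fin (2 * n), (i : ℕ) % 2 = 1 →
    (v (nextIdx i)).1 = (v i).1 ∧ (v (nextIdx i)).2 ≠ (v i).2) ∧
  (∀ i j : Fin (2 * n), (i : ℕ) % 2 = 1 → (j : ℕ) % 2 = 1 → (v i).1 = (v j).1 → i = j) ∧
  (∀ i j : Fin (2 * n), (i : ℕ) % 2 = 0 → (j : ℕ) % 2 = 0 → (v i).2 = (v j).2 → i = j) ∧
  Function.Injective v ∧
  (∀ i j : Fin (2 * n), i ≠ j → nextIdx i ≠ j → nextIdx j ≠ i →
    segment ℝ (v i) (v (nextIdx i)) ∩ segment ℝ (v j) (v (nextIdx j)) = ∅) ∧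
  (∀ i j : Fin (2 * n), nextIdx i = j → i ≠ j →
    segment ℝ (v i) (v (nextIdx i)) ∩ segment ℝ (v j) (v (nextIdx j)) = {v j})


namespace RP

open Finset

/-- indicator that `a` is weakly to the left of `s` -/
noncomputable def hX (a s : ℝ) : ZMod 2 := if a ≤ s then 1 else 0
/-- indicator that `b` is strictly above `t` -/
noncomputable def gY (b t : ℝ) : ZMod 2 := if t < b then 1 else 0

/-- parity of the number of vertices in the upper left quadrant -/
noncomputable def par (n : ℕ) (X Y : ℕ → ℝ) (p : ℝ × ℝ) : ZMod 2 :=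
  ∑ i ∈ range n, (hX (X i) p.1 + hX (X (i + 1)) p.1) * gY (Y i) p.2

/-- horizontal edge -/
def HE (X Y : ℕ → ℝ) (i : ℕ) : Set (ℝ × ℝ) :=
  {q | q.2 = Y i ∧ q.1 ∈ Set.uIcc (X i) (X (i + 1))}

/-- vertical edge -/
def VE (X Y : ℕ → ℝ) (i : ℕ) : Set (ℝ × ℝ) :=
  {q | q.1 = X (i + 1) ∧ q.2 ∈ Set.uIcc (Y i) (Y (i + 1))}

/-- boundary -/
def BB (n : ℕ) (X Y : ℕ → ℝ) : Set (ℝ × ℝ) :=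
  {q | ∃ i < n, q ∈ HE X Y i ∨ q ∈ VE X Y i}

/-- closed region -/
def RR (n : ℕ) (X Y : ℕ → ℝ) : Set (ℝ × ℝ) :=
  {q | q ∈ BB n X Y ∨ par n X Y q = 1}

/-- simple rectilinear polygons in coordinate form -/
structure Poly (n : ℕ) (X Y : ℕ → ℝ) : Prop where
  hn : 2 ≤ n
  cX : X n = X 0
  cY : Y n = Y 0
  iX : ∀ i < n, ∀ j < n, X i = X j → i = j
  iY : ∀ i < n, ∀ j < n, Y i = Y j → i = j
  cross : ∀ i < n, ∀ j < n, X (j + 1) ∈ Set.uIcc (X i) (X (i + 1)) →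
    Y i ∈ Set.uIcc (Y j) (Y (j + 1)) → X (j + 1) = X i ∨ X (j + 1) = X (i + 1)

lemma z2 (a : ZMod 2) : a = 0 ∨ a = 1 := by revert a; decide
lemma z2a (a : ZMod 2) : a + a = 0 := by revert a; decide

lemma gY_ne {a b t : ℝ} (h : gY a t + gY b t ≠ 0) : t ∈ Set.uIcc a b := by
  rw [Set.mem_uIcc]
  unfold gY at h
  split_ifs at h with h1 h2 h2
  · exact absurd (by decide) h
  · right; constructor <;> linarith
  · left; constructor <;> linarith
  · exact absurd (by decide) h

lemma hX_ne {a b t : ℝ} (h : hX a t + hX b t ≠ 0) : t ∈ Set.uIcc a b := by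
  rw [Set.mem_uIcc]
  unfold hX at h
  split_ifs at h with h1 h2 h2
  · exact absurd (by decide) h
  · left; constructor <;> linarith
  · right; constructor <;> linarith
  · exact absurd (by decide) h

lemma hX_ne' {a s t : ℝ} (h : hX a s ≠ hX a t) : a ∈ Set.uIcc s t := by
  rw [Set.mem_uIcc]
  unfold hX at h
  split_ifs at h with h1 h2 h2
  · exact absurd rfl h
  · right; constructor <;> linarith
  · left; constructor <;> linarith
  · exact absurd rfl h

lemma gY_ne' {a s t : ℝ} (h : gY a s ≠ gY a t) : a ∈ Set.uIcc s t := by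
  rw [Set.mem_uIcc]
  unfold gY at h
  split_ifs at h with h1 h2 h2
  · exact absurd rfl h
  · left; constructor <;> linarith
  · right; constructor <;> linarith
  · exact absurd rfl h

/-- strict betweenness -/
def Btw (a s b : ℝ) : Prop := (a < s ∧ s < b) ∨ (b < s ∧ s < a)

lemma hX_btw {a s b : ℝ} (h : Btw a s b) : hX a s + hX b s = 1 := by
  unfold hX
  rcases h with ⟨h1, h2⟩ | ⟨h1, h2⟩
  · rw [if_pos h1.le, if_neg (not_le.2 h2)]; rfl
  · rw [if_pos h1.le, if_neg (not_le.2 h2)]; rfl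

lemma gY_btw {a s b : ℝ} (h : Btw a s b) : gY a s + gY b s = 1 := by
  unfold gY
  rcases h with ⟨h1, h2⟩ | ⟨h1, h2⟩
  · rw [if_pos h2, if_neg (not_lt.2 h1.le)]; rfl
  · rw [if_pos h2, if_neg (not_lt.2 h1.le)]; rfl

lemma gY_btw' {t b t' : ℝ} (h : Btw t b t') : gY b t + gY b t' = 1 := by
  unfold gY
  rcases h with ⟨h1, h2⟩ | ⟨h1, h2⟩
  · rw [if_pos h1, if_neg (not_lt.2 h2.le)]; rfl
  · rw [if_pos h1, if_neg (not_lt.2 h2.le)]; rfl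

lemma hX_btw' {t b t' : ℝ} (h : Btw t b t') : hX b t + hX b t' = 1 := by
  unfold hX
  rcases h with ⟨h1, h2⟩ | ⟨h1, h2⟩
  · rw [if_pos h2.le, if_neg (not_le.2 h1)]; rfl
  · rw [if_pos h2.le, if_neg (not_le.2 h1)]; rfl

variable {n : ℕ} {X Y : ℕ → ℝ}

lemma par_v (h : Poly n X Y) (p : ℝ × ℝ) :
    par n X Y p = ∑ i ∈ range n, hX (X (i + 1)) p.1 * (gY (Y i) p.2 + gY (Y (i + 1)) p.2) := by
  have h1 : ∑ i ∈ range n, hX (X i) p.1 * gY (Y i) p.2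
      = ∑ i ∈ range n, hX (X (i + 1)) p.1 * gY (Y (i + 1)) p.2 := by
    have e1 := Finset.sum_range_succ (fun i => hX (X i) p.1 * gY (Y i) p.2) n
    have e2 := Finset.sum_range_succ' (fun i => hX (X i) p.1 * gY (Y i) p.2) n
    rw [e1] at e2
    simp only [h.cX, h.cY] at e2
    exact add_right_cancel e2
  unfold par
  simp only [add_mul, mul_add, Finset.sum_add_distrib, h1]
  rw [add_comm]

lemma par_vmove {s t t' : ℝ} (hB : ∀ y ∈ Set.uIcc t t', (s, y) ∉ BB n X Y) :
    par n X Y (s, t) = par n X Y (s, t') := by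
  unfold par
  apply Finset.sum_congr rfl
  intro i hi
  by_contra hne
  have h1 : hX (X i) s + hX (X (i + 1)) s ≠ 0 := by
    intro h0; apply hne; simp [h0]
  have h2 : gY (Y i) t ≠ gY (Y i) t' := by
    intro h0; apply hne; simp [h0]
  exact hB _ (gY_ne' h2) ⟨i, by simpa using hi, Or.inl ⟨rfl, hX_ne h1⟩⟩

lemma par_hmove (h : Poly n X Y) {s s' t : ℝ} (hB : ∀ x ∈ Set.uIcc s s', (x, t) ∉ BB n X Y) :
    par n X Y (s, t) = par n X Y (s', t) := by
  rw [par_v h, par_v h]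
  apply Finset.sum_congr rfl
  intro i hi
  by_contra hne
  have h1 : gY (Y i) t + gY (Y (i + 1)) t ≠ 0 := by
    intro h0; apply hne; simp [h0]
  have h2 : hX (X (i + 1)) s ≠ hX (X (i + 1)) s' := by
    intro h0; apply hne; simp [h0]
  exact hB _ (hX_ne' h2) ⟨i, by simpa using hi, Or.inr ⟨rfl, gY_ne h1⟩⟩

lemma par_vtog (h : Poly n X Y) {s t t' : ℝ} {i : ℕ} (hi : i < n) (hs : Btw (X i) s (X (i + 1)))
    (ht : Btw t (Y i) t') (hB : ∀ y ∈ Set.uIcc t t', (s, y) ∈ BB n X Y → y = Y i) :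
    par n X Y (s, t) + par n X Y (s, t') = 1 := by
  unfold par
  rw [← Finset.sum_add_distrib, Finset.sum_eq_single i]
  · simp only
    rw [← mul_add, hX_btw hs, gY_btw' ht]; rfl
  · intro j hj hji
    by_contra hne
    simp only [← mul_add] at hne
    have h1 : hX (X j) s + hX (X (j + 1)) s ≠ 0 := by
      intro h0; apply hne; simp [h0]
    have h2 : gY (Y j) t ≠ gY (Y j) t' := by
      intro h0; apply hne; rw [h0, z2a, mul_zero]
    have hj' : j < n := by simpa using hj
    have := hB _ (gY_ne' h2) ⟨j, hj', Or.inl ⟨rfl, hX_ne h1⟩⟩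
    exact hji (h.iY _ hj' _ hi this)
  · intro h0; simp at h0; omega

lemma Poly.iX' (h : Poly n X Y) {i j : ℕ} (hi : i < n) (hj : j < n)
    (e : X (i + 1) = X (j + 1)) : i = j := by
  have cX := h.cX
  have hn := h.hn
  rcases Nat.lt_or_ge (i + 1) n with h1 | h1 <;> rcases Nat.lt_or_ge (j + 1) n with h2 | h2
  · have := h.iX _ h1 _ h2 e; omega
  · have e2 : j + 1 = n := by omega
    rw [e2, cX] at e
    have := h.iX _ h1 _ (by omega) e; omega
  · have e2 : i + 1 = n := by omega
    rw [e2, cX] at e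
    have := h.iX _ (by omega) _ h2 e; omega
  · omega

lemma par_htog (h : Poly n X Y) {s s' t : ℝ} {i : ℕ} (hi : i < n) (hs : Btw (Y i) t (Y (i + 1)))
    (ht : Btw s (X (i + 1)) s') (hB : ∀ x ∈ Set.uIcc s s', (x, t) ∈ BB n X Y → x = X (i + 1)) :
    par n X Y (s, t) + par n X Y (s', t) = 1 := by
  rw [par_v h, par_v h]
  rw [← Finset.sum_add_distrib, Finset.sum_eq_single i]
  · simp only
    rw [← add_mul, gY_btw hs, hX_btw' ht]; rfl
  · intro j hj hji
    by_contra hne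
    simp only [← add_mul] at hne
    have h1 : gY (Y j) t + gY (Y (j + 1)) t ≠ 0 := by
      intro h0; apply hne; simp [h0]
    have h2 : hX (X (j + 1)) s ≠ hX (X (j + 1)) s' := by
      intro h0; apply hne; rw [h0, z2a, zero_mul]
    have hj' : j < n := by simpa using hj
    have := hB _ (hX_ne' h2) ⟨j, hj', Or.inr ⟨rfl, gY_ne h1⟩⟩
    exact hji (h.iX' hj' hi this)
  · intro h0; simp at h0; omega

lemma par_top {p : ℝ × ℝ} (hp : ∀ i < n, Y i ≤ p.2) : par n X Y p = 0 := by
  unfold par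
  apply Finset.sum_eq_zero
  intro i hi
  have : gY (Y i) p.2 = 0 := by
    unfold gY; rw [if_neg]; exact not_lt.2 (hp i (by simpa using hi))
  rw [this, mul_zero]

lemma Poly.exX (h : Poly n X Y) {i : ℕ} (hi : i < n) : ∃ j < n, X (i + 1) = X j := by
  rcases Nat.lt_or_ge (i + 1) n with h1 | h1
  · exact ⟨_, h1, rfl⟩
  · have e2 : i + 1 = n := by omega
    exact ⟨0, by omega, by rw [e2, h.cX]⟩

lemma Poly.exY (h : Poly n X Y) {i : ℕ} (hi : i < n) : ∃ j < n, Y (i + 1) = Y j := by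
  rcases Nat.lt_or_ge (i + 1) n with h1 | h1
  · exact ⟨_, h1, rfl⟩
  · have e2 : i + 1 = n := by omega
    exact ⟨0, by omega, by rw [e2, h.cY]⟩

lemma par_right (h : Poly n X Y) {p : ℝ × ℝ} (hp : ∀ i < n, X i ≤ p.1) : par n X Y p = 0 := by
  unfold par
  apply Finset.sum_eq_zero
  intro i hi
  have hi' : i < n := by simpa using hi
  obtain ⟨j, hj, e⟩ := h.exX hi'
  have h1 : hX (X i) p.1 = 1 := by unfold hX; rw [if_pos (hp _ hi')]
  have h2 : hX (X (i + 1)) p.1 = 1 := by rw [e]; unfold hX; rw [if_pos (hp _ hj)]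
  rw [h1, h2, z2a, zero_mul]

lemma par_left (h : Poly n X Y) {p : ℝ × ℝ} (hp : ∀ i < n, p.1 < X i) : par n X Y p = 0 := by
  unfold par
  apply Finset.sum_eq_zero
  intro i hi
  have hi' : i < n := by simpa using hi
  obtain ⟨j, hj, e⟩ := h.exX hi'
  have h1 : hX (X i) p.1 = 0 := by unfold hX; rw [if_neg (not_le.2 (hp _ hi'))]
  have h2 : hX (X (i + 1)) p.1 = 0 := by rw [e]; unfold hX; rw [if_neg (not_le.2 (hp _ hj))]
  rw [h1, h2, z2a, zero_mul]

lemma par_bot (h : Poly n X Y) {p : ℝ × ℝ} (hp : ∀ i < n, p.2 < Y i) : par n X Y p = 0 := by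
  rw [par_v h]
  apply Finset.sum_eq_zero
  intro i hi
  have hi' : i < n := by simpa using hi
  obtain ⟨j, hj, e⟩ := h.exY hi'
  have h1 : gY (Y i) p.2 = 1 := by unfold gY; rw [if_pos (hp _ hi')]
  have h2 : gY (Y (i + 1)) p.2 = 1 := by rw [e]; unfold gY; rw [if_pos (hp _ hj)]
  rw [h1, h2, z2a, mul_zero]

/-- a bound for all coordinates -/
lemma exists_bound (n : ℕ) (Z : ℕ → ℝ) : ∃ M > 0, ∀ i ≤ n, |Z i| < M := by
  refine ⟨∑ i ∈ range (n + 1), |Z i| + 1, by positivity, ?_⟩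
  intro i hi
  have := Finset.single_le_sum (f := fun i => |Z i|) (fun i _ => abs_nonneg (Z i))
    (show i ∈ range (n + 1) by simp; omega)
  linarith

/-! topology of the boundary -/

lemma HE_closed (i : ℕ) : IsClosed (HE X Y i) :=
  (isClosed_eq continuous_snd continuous_const).inter
    ((isCompact_uIcc (a := X i) (b := X (i + 1))).isClosed.preimage continuous_fst)

lemma VE_closed (i : ℕ) : IsClosed (VE X Y i) :=
  (isClosed_eq continuous_fst continuous_const).inter
    ((isCompact_uIcc (a := Y i) (b := Y (i + 1))).isClosed.preimage continuous_snd)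

lemma BB_eq : BB n X Y = ⋃ i ∈ range n, (HE X Y i ∪ VE X Y i) := by
  ext q; simp [BB]

lemma BB_closed : IsClosed (BB n X Y) := by
  rw [BB_eq]
  exact isClosed_biUnion_finset fun i _ => (HE_closed i).union (VE_closed i)

/-- boxes -/
def Box (q : ℝ × ℝ) (e : ℝ) : Set (ℝ × ℝ) := {p | |p.1 - q.1| < e ∧ |p.2 - q.2| < e}

lemma box_nhds {q : ℝ × ℝ} {S : Set (ℝ × ℝ)} (hS : IsOpen S) (hq : q ∈ S) :
    ∃ e > 0, Box q e ⊆ S := by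
  obtain ⟨e, he, h⟩ := Metric.isOpen_iff.1 hS q hq
  refine ⟨e, he, fun p hp => h ?_⟩
  rw [Metric.mem_ball, Prod.dist_eq, Real.dist_eq, Real.dist_eq]
  exact max_lt hp.1 hp.2

lemma box_open (q : ℝ × ℝ) (e : ℝ) : IsOpen (Box q e) := by
  exact (isOpen_lt (f := fun p : ℝ × ℝ => |p.1 - q.1|) (by fun_prop) continuous_const).inter
    (isOpen_lt (f := fun p : ℝ × ℝ => |p.2 - q.2|) (by fun_prop) continuous_const)

lemma box_mem (q : ℝ × ℝ) {e : ℝ} (he : 0 < e) : q ∈ Box q e := by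
  constructor <;> simpa using he

lemma abs_mid {a x y e : ℝ} {z : ℝ} (hx : |x - a| < e) (hy : |y - a| < e)
    (hz : z ∈ Set.uIcc x y) : |z - a| < e := by
  rw [abs_lt] at *
  rw [Set.mem_uIcc] at hz
  constructor <;> rcases hz with h | h <;> linarith [h.1, h.2]

lemma par_box (h : Poly n X Y) {q p p' : ℝ × ℝ} {e : ℝ}
    (hB : ∀ z ∈ Box q e, z ∉ BB n X Y) (hp : p ∈ Box q e) (hp' : p' ∈ Box q e) :
    par n X Y p = par n X Y p' := by
  obtain ⟨s, t⟩ := p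
  obtain ⟨s', t'⟩ := p'
  rw [par_hmove h (s := s) (s' := s') (t := t), par_vmove (s := s') (t := t) (t' := t')]
  · intro y hy; exact hB _ ⟨hp'.1, abs_mid hp.2 hp'.2 hy⟩
  · intro x hx; exact hB _ ⟨abs_mid hp.1 hp'.1 hx, hp.2⟩

lemma par_loc (h : Poly n X Y) {q : ℝ × ℝ} (hq : q ∉ BB n X Y) :
    ∃ e > 0, ∀ p ∈ Box q e, p ∉ BB n X Y ∧ par n X Y p = par n X Y q := by
  obtain ⟨e, he, hS⟩ := box_nhds BB_closed.isOpen_compl (show q ∈ (BB n X Y)ᶜ from hq)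
  exact ⟨e, he, fun p hp => ⟨hS hp, par_box h (fun z hz => hS hz) hp (box_mem q he)⟩⟩

lemma par_cont (h : Poly n X Y) : ContinuousOn (par n X Y) (BB n X Y)ᶜ := by
  intro q hq
  apply ContinuousAt.continuousWithinAt
  obtain ⟨e, he, hS⟩ := par_loc h hq
  have : par n X Y =ᶠ[nhds q] fun _ => par n X Y q := by
    filter_upwards [(box_open q e).mem_nhds (box_mem q he)] with p hp
    exact (hS p hp).2
  exact continuousAt_const.congr this.symm

lemma RR_closed (h : Poly n X Y) : IsClosed (RR n X Y) := by
  rw [← isOpen_compl_iff, isOpen_iff_mem_nhds]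
  intro q hq
  have hq1 : q ∉ BB n X Y := fun h0 => hq (Or.inl h0)
  have hq2 : par n X Y q ≠ 1 := fun h0 => hq (Or.inr h0)
  obtain ⟨e, he, hS⟩ := par_loc h hq1
  filter_upwards [(box_open q e).mem_nhds (box_mem q he)] with p hp
  rintro (h0 | h0)
  · exact (hS p hp).1 h0
  · exact hq2 ((hS p hp).2 ▸ h0)

open MeasureTheory in
lemma BB_null : volume (BB n X Y) = 0 := by
  rw [BB_eq]
  refine (measure_biUnion_null_iff (Finset.countable_toSet _)).2 fun i _ => ?_
  refine measure_union_null ?_ ?_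
  · refine measure_mono_null (t := Set.univ ×ˢ {Y i}) (fun q hq => ⟨trivial, hq.1⟩) ?_
    rw [Measure.volume_eq_prod, Measure.prod_prod]; simp
  · refine measure_mono_null (t := {X (i + 1)} ×ˢ Set.univ) (fun q hq => ⟨hq.1, trivial⟩) ?_
    rw [Measure.volume_eq_prod, Measure.prod_prod]; simp

end RP


namespace RP

open Finset

variable {n : ℕ} {X Y : ℕ → ℝ}

lemma near (b : ℝ × ℝ) : ∃ e > 0, ∀ p ∈ Box b e, p ∈ BB n X Y →
    ∃ i < n, (p ∈ HE X Y i ∧ b ∈ HE X Y i) ∨ (p ∈ VE X Y i ∧ b ∈ VE X Y i) := by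
  have hc : IsClosed (⋃ i ∈ range n, ({p | p ∈ HE X Y i ∧ b ∉ HE X Y i} ∪
      {p | p ∈ VE X Y i ∧ b ∉ VE X Y i})) := by
    refine isClosed_biUnion_finset fun i _ => IsClosed.union ?_ ?_
    · exact (HE_closed i).inter isClosed_const
    · exact (VE_closed i).inter isClosed_const
  obtain ⟨e, he, hS⟩ := box_nhds hc.isOpen_compl (q := b) (by simp)
  refine ⟨e, he, fun p hp hpB => ?_⟩
  have h1 := hS hp
  simp only [Set.mem_compl_iff, Set.mem_iUnion, Set.mem_union, Set.mem_ofPred_eq, not_exists,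
    Finset.mem_range, not_or, not_and, not_not] at h1
  obtain ⟨i, hi, h2 | h2⟩ := hpB
  · exact ⟨i, hi, Or.inl ⟨h2, (h1 i hi).1 h2⟩⟩
  · exact ⟨i, hi, Or.inr ⟨h2, (h1 i hi).2 h2⟩⟩

lemma box_mono {b : ℝ × ℝ} {e e' : ℝ} (h : e ≤ e') : Box b e ⊆ Box b e' :=
  fun _ hp => ⟨hp.1.trans_le h, hp.2.trans_le h⟩

lemma side (b c e : ℝ) (he : 0 < e) (hc : e ≤ |c - b|) : ∃ I J : Set ℝ,
    IsPreconnected I ∧ IsPreconnected J ∧ b ∈ closure I ∧ b ∈ closure J ∧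
    (∀ x, |x - b| < e ↔ x ∈ I ∨ x ∈ J ∨ x = b) ∧ (∀ x ∈ I, Btw b x c) ∧
    (∀ x ∈ J, x ∉ Set.uIcc b c) ∧ b ∉ I ∧ b ∉ J ∧ ∀ x ∈ I, ∀ x' ∈ J, Btw x b x' := by
  rcases le_total 0 (c - b) with h | h
  · rw [abs_of_nonneg h] at hc
    refine ⟨Set.Ioo b (b + e), Set.Ioo (b - e) b, isPreconnected_Ioo, isPreconnected_Ioo,
      ?_, ?_, ?_, ?_, ?_, ?_, ?_, ?_⟩
    · rw [closure_Ioo (by linarith)]; constructor <;> linarith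
    · rw [closure_Ioo (by linarith)]; constructor <;> linarith
    · intro x; rw [abs_lt, Set.mem_Ioo, Set.mem_Ioo]
      constructor
      · rintro ⟨h1, h2⟩
        rcases lt_trichotomy x b with h3 | h3 | h3
        · right; left; constructor <;> linarith
        · right; right; exact h3
        · left; constructor <;> linarith
      · rintro (h1 | h1 | h1) <;> constructor <;> first | linarith [h1.1, h1.2] | linarith
    · intro x hx; left; exact ⟨hx.1, by linarith [hx.2]⟩
    · intro x hx; rw [Set.mem_uIcc]; rintro (h1 | h1) <;> linarith [h1.1, h1.2, hx.1, hx.2]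
    · intro h1; exact lt_irrefl _ h1.1
    · intro h1; exact lt_irrefl _ h1.2
    · intro x hx x' hx'; right; exact ⟨hx'.2, hx.1⟩
  · rw [abs_of_nonpos h] at hc
    refine ⟨Set.Ioo (b - e) b, Set.Ioo b (b + e), isPreconnected_Ioo, isPreconnected_Ioo,
      ?_, ?_, ?_, ?_, ?_, ?_, ?_, ?_⟩
    · rw [closure_Ioo (by linarith)]; constructor <;> linarith
    · rw [closure_Ioo (by linarith)]; constructor <;> linarith
    · intro x; rw [abs_lt, Set.mem_Ioo, Set.mem_Ioo]
      constructor
      · rintro ⟨h1, h2⟩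
        rcases lt_trichotomy x b with h3 | h3 | h3
        · left; constructor <;> linarith
        · right; right; exact h3
        · right; left; constructor <;> linarith
      · rintro (h1 | h1 | h1) <;> constructor <;> first | linarith [h1.1, h1.2] | linarith
    · intro x hx; right; exact ⟨by linarith [hx.1], hx.2⟩
    · intro x hx; rw [Set.mem_uIcc]; rintro (h1 | h1) <;> linarith [h1.1, h1.2, hx.1, hx.2]
    · intro h1; exact lt_irrefl _ h1.2
    · intro h1; exact lt_irrefl _ h1.1
    · intro x hx x' hx'; left; exact ⟨hx.2, hx'.1⟩

/-- local two-sidedness of the boundary at `b` -/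
def Loc (n : ℕ) (X Y : ℕ → ℝ) (b : ℝ × ℝ) : Prop :=
  ∃ U P N : Set (ℝ × ℝ), IsOpen U ∧ b ∈ U ∧ IsPreconnected P ∧ IsPreconnected N ∧
    P ⊆ (BB n X Y)ᶜ ∧ N ⊆ (BB n X Y)ᶜ ∧ (∀ q ∈ U, q ∈ BB n X Y ∨ q ∈ P ∨ q ∈ N) ∧
    (∀ q ∈ U, q ∈ BB n X Y → q ∈ closure P ∧ q ∈ closure N) ∧
    ∃ p ∈ P, ∃ q ∈ N, par n X Y p + par n X Y q = 1

lemma full_pre (b e : ℝ) : IsPreconnected {x : ℝ | |x - b| < e} := by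
  have : {x : ℝ | |x - b| < e} = Set.Ioo (b - e) (b + e) := by
    ext x; simp only [Set.mem_ofPred_eq, abs_lt, Set.mem_Ioo]
    constructor <;> rintro ⟨h1, h2⟩ <;> constructor <;> linarith
  rw [this]; exact isPreconnected_Ioo

lemma mem_cl_prod {S T : Set ℝ} {q : ℝ × ℝ} (h1 : q.1 ∈ closure S) (h2 : q.2 ∈ closure T) :
    q ∈ closure (S ×ˢ T) := by
  rw [closure_prod_eq]; exact ⟨h1, h2⟩

lemma closure_nonempty {S : Set ℝ} {b : ℝ} (h : b ∈ closure S) : ∃ x, x ∈ S := by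
  by_contra h0
  push Not at h0
  rw [Set.eq_empty_of_forall_notMem h0] at h
  simp at h

lemma loc_h (h : Poly n X Y) {b : ℝ × ℝ} {i : ℕ} (hi : i < n) (hb2 : b.2 = Y i)
    (hb1 : Btw (X i) b.1 (X (i + 1))) (hV : ∀ j < n, b ∉ VE X Y j) : Loc n X Y b := by
  obtain ⟨e0, he0, hnear⟩ := near (n := n) (X := X) (Y := Y) b
  have hd1 : 0 < |X i - b.1| := abs_pos.2 (by rcases hb1 with h | h <;> intro h0 <;> linarith [h.1, h.2])
  have hd2 : 0 < |X (i + 1) - b.1| :=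
    abs_pos.2 (by rcases hb1 with h | h <;> intro h0 <;> linarith [h.1, h.2])
  obtain ⟨e, he, hle⟩ : ∃ e > 0, e ≤ e0 ∧ e ≤ |X i - b.1| ∧ e ≤ |X (i + 1) - b.1| ∧ e ≤ 1 :=
    ⟨min (min e0 (|X i - b.1|)) (min (|X (i + 1) - b.1|) 1), by positivity, by simp, by simp,
      by simp, by simp⟩
  obtain ⟨hle0, hle1, hle2, hle3⟩ := hle
  have hB : ∀ p ∈ Box b e, p ∈ BB n X Y → p.2 = b.2 := by
    intro p hp hpB
    obtain ⟨j, hj, h1 | h1⟩ := hnear p (box_mono hle0 hp) hpB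
    · rw [h1.1.1, h1.2.1]
    · exact absurd h1.2 (hV j hj)
  have hX : ∀ x, |x - b.1| < e → Btw (X i) x (X (i + 1)) := by
    intro x hx
    rw [abs_lt] at hx
    rcases hb1 with h1 | h1
    · rw [abs_of_neg (by linarith)] at hle1
      rw [abs_of_pos (by linarith)] at hle2
      left; constructor <;> linarith
    · rw [abs_of_pos (by linarith)] at hle1
      rw [abs_of_neg (by linarith)] at hle2
      right; constructor <;> linarith
  obtain ⟨I, J, pI, pJ, cI, cJ, hIJ, hI, hJ, bI, bJ, hT⟩ := side b.2 (b.2 + 1) e he (by simpa using hle3)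
  have iI : ∀ y ∈ I, |y - b.2| < e := fun y hy => (hIJ y).2 (Or.inl hy)
  have iJ : ∀ y ∈ J, |y - b.2| < e := fun y hy => (hIJ y).2 (Or.inr (Or.inl hy))
  refine ⟨Box b e, {x | |x - b.1| < e} ×ˢ I, {x | |x - b.1| < e} ×ˢ J, box_open _ _, box_mem _ he,
    (full_pre _ _).prod pI, (full_pre _ _).prod pJ, ?_, ?_, ?_, ?_, ?_⟩
  · rintro p ⟨h1, h2⟩ h3
    exact bI (hB p ⟨h1, iI _ h2⟩ h3 ▸ h2)
  · rintro p ⟨h1, h2⟩ h3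
    exact bJ (hB p ⟨h1, iJ _ h2⟩ h3 ▸ h2)
  · rintro q ⟨h1, h2⟩
    rcases (hIJ _).1 h2 with h3 | h3 | h3
    · right; left; exact ⟨h1, h3⟩
    · right; right; exact ⟨h1, h3⟩
    · left; refine ⟨i, hi, Or.inl ⟨h3.trans hb2, ?_⟩⟩
      rw [Set.mem_uIcc]
      rcases hX _ h1 with h4 | h4
      · left; exact ⟨h4.1.le, h4.2.le⟩
      · right; exact ⟨h4.1.le, h4.2.le⟩
  · intro q hq hqB
    have := hB q hq hqB
    exact ⟨mem_cl_prod (subset_closure hq.1) (this ▸ cI), mem_cl_prod (subset_closure hq.1) (this ▸ cJ)⟩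
  · obtain ⟨y, hy⟩ := closure_nonempty cI
    obtain ⟨y', hy'⟩ := closure_nonempty cJ
    have hb0 : |b.1 - b.1| < e := by simpa using he
    refine ⟨(b.1, y), ⟨hb0, hy⟩, (b.1, y'), ⟨hb0, hy'⟩, ?_⟩
    apply par_vtog h hi hb1 (hb2 ▸ hT y hy y' hy')
    intro z hz hzB
    rw [← hb2]
    exact hB (b.1, z) ⟨hb0, abs_mid (iI _ hy) (iJ _ hy') hz⟩ hzB

lemma loc_v (h : Poly n X Y) {b : ℝ × ℝ} {i : ℕ} (hi : i < n) (hb1 : b.1 = X (i + 1))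
    (hb2 : Btw (Y i) b.2 (Y (i + 1))) (hV : ∀ j < n, b ∉ HE X Y j) : Loc n X Y b := by
  obtain ⟨e0, he0, hnear⟩ := near (n := n) (X := X) (Y := Y) b
  have hd1 : 0 < |Y i - b.2| := abs_pos.2 (by rcases hb2 with h | h <;> intro h0 <;> linarith [h.1, h.2])
  have hd2 : 0 < |Y (i + 1) - b.2| :=
    abs_pos.2 (by rcases hb2 with h | h <;> intro h0 <;> linarith [h.1, h.2])
  obtain ⟨e, he, hle⟩ : ∃ e > 0, e ≤ e0 ∧ e ≤ |Y i - b.2| ∧ e ≤ |Y (i + 1) - b.2| ∧ e ≤ 1 :=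
    ⟨min (min e0 (|Y i - b.2|)) (min (|Y (i + 1) - b.2|) 1), by positivity, by simp, by simp,
      by simp, by simp⟩
  obtain ⟨hle0, hle1, hle2, hle3⟩ := hle
  have hB : ∀ p ∈ Box b e, p ∈ BB n X Y → p.1 = b.1 := by
    intro p hp hpB
    obtain ⟨j, hj, h1 | h1⟩ := hnear p (box_mono hle0 hp) hpB
    · exact absurd h1.2 (hV j hj)
    · rw [h1.1.1, h1.2.1]
  have hX : ∀ x, |x - b.2| < e → Btw (Y i) x (Y (i + 1)) := by
    intro x hx
    rw [abs_lt] at hx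
    rcases hb2 with h1 | h1
    · rw [abs_of_neg (by linarith)] at hle1
      rw [abs_of_pos (by linarith)] at hle2
      left; constructor <;> linarith
    · rw [abs_of_pos (by linarith)] at hle1
      rw [abs_of_neg (by linarith)] at hle2
      right; constructor <;> linarith
  obtain ⟨I, J, pI, pJ, cI, cJ, hIJ, hI, hJ, bI, bJ, hT⟩ := side b.1 (b.1 + 1) e he (by simpa using hle3)
  have iI : ∀ y ∈ I, |y - b.1| < e := fun y hy => (hIJ y).2 (Or.inl hy)
  have iJ : ∀ y ∈ J, |y - b.1| < e := fun y hy => (hIJ y).2 (Or.inr (Or.inl hy))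
  refine ⟨Box b e, I ×ˢ {x | |x - b.2| < e}, J ×ˢ {x | |x - b.2| < e}, box_open _ _, box_mem _ he,
    pI.prod (full_pre _ _), pJ.prod (full_pre _ _), ?_, ?_, ?_, ?_, ?_⟩
  · rintro p ⟨h1, h2⟩ h3
    exact bI (hB p ⟨iI _ h1, h2⟩ h3 ▸ h1)
  · rintro p ⟨h1, h2⟩ h3
    exact bJ (hB p ⟨iJ _ h1, h2⟩ h3 ▸ h1)
  · rintro q ⟨h2, h1⟩
    rcases (hIJ _).1 h2 with h3 | h3 | h3
    · right; left; exact ⟨h3, h1⟩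
    · right; right; exact ⟨h3, h1⟩
    · left; refine ⟨i, hi, Or.inr ⟨h3.trans hb1, ?_⟩⟩
      rw [Set.mem_uIcc]
      rcases hX _ h1 with h4 | h4
      · left; exact ⟨h4.1.le, h4.2.le⟩
      · right; exact ⟨h4.1.le, h4.2.le⟩
  · intro q hq hqB
    have := hB q hq hqB
    exact ⟨mem_cl_prod (this ▸ cI) (subset_closure hq.2), mem_cl_prod (this ▸ cJ) (subset_closure hq.2)⟩
  · obtain ⟨y, hy⟩ := closure_nonempty cI
    obtain ⟨y', hy'⟩ := closure_nonempty cJ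
    have hb0 : |b.2 - b.2| < e := by simpa using he
    refine ⟨(y, b.2), ⟨hy, hb0⟩, (y', b.2), ⟨hy', hb0⟩, ?_⟩
    apply par_htog h hi hb2 (hb1 ▸ hT y hy y' hy')
    intro z hz hzB
    rw [← hb1]
    exact hB (z, b.2) ⟨abs_mid (iI _ hy) (iJ _ hy') hz, hb0⟩ hzB

lemma Btw.symm {a s b : ℝ} (h : Btw a s b) : Btw b s a := Or.symm h

lemma Poly.neX (h : Poly n X Y) {i : ℕ} (hi : i < n) : X i ≠ X (i + 1) := by
  intro e
  have hn := h.hn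
  rcases Nat.lt_or_ge (i + 1) n with h1 | h1
  · have := h.iX _ hi _ h1 e; omega
  · have e2 : i + 1 = n := by omega
    rw [e2, h.cX] at e
    have := h.iX _ hi _ (by omega) e; omega

lemma Poly.neY (h : Poly n X Y) {i : ℕ} (hi : i < n) : Y i ≠ Y (i + 1) := by
  intro e
  have hn := h.hn
  rcases Nat.lt_or_ge (i + 1) n with h1 | h1
  · have := h.iY _ hi _ h1 e; omega
  · have e2 : i + 1 = n := by omega
    rw [e2, h.cY] at e
    have := h.iY _ hi _ (by omega) e; omega

lemma Poly.succ_eq (h : Poly n X Y) {i j : ℕ} (hi : i < n) (hj : j < n)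
    (e : X i = X (j + 1)) : i = j + 1 ∨ (i = 0 ∧ j + 1 = n) := by
  rcases Nat.lt_or_ge (j + 1) n with h1 | h1
  · left; exact h.iX _ hi _ h1 e
  · have e2 : j + 1 = n := by omega
    rw [e2, h.cX] at e
    right; exact ⟨h.iX _ hi _ (by omega) e, e2⟩

lemma loc_c (h : Poly n X Y) {b : ℝ × ℝ} {i j : ℕ} (hi : i < n) (hj : j < n)
    (hbi : b ∈ HE X Y i) (hbj : b ∈ VE X Y j) : Loc n X Y b := by
  obtain ⟨e0, he0, hnear⟩ := near (n := n) (X := X) (Y := Y) b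
  obtain ⟨hi2, hi1⟩ := hbi
  obtain ⟨hj1, hj2⟩ := hbj
  have hcr := h.cross i hi j hj (hj1 ▸ hi1) (hi2 ▸ hj2)
  obtain ⟨x', hx', ux, bx⟩ : ∃ x', x' ≠ b.1 ∧ Set.uIcc (X i) (X (i + 1)) = Set.uIcc b.1 x' ∧
      ∀ s, Btw b.1 s x' → Btw (X i) s (X (i + 1)) := by
    rw [hj1]
    have := h.neX hi
    rcases hcr with h1 | h1
    · exact ⟨X (i + 1), by rw [h1]; exact this.symm, by rw [h1], by rw [h1]; exact fun _ => id⟩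
    · exact ⟨X i, by rw [h1]; exact this, by rw [h1, Set.uIcc_comm], by
        rw [h1]; exact fun _ hs => hs.symm⟩
  obtain ⟨y', hy', uy⟩ : ∃ y', y' ≠ b.2 ∧ Set.uIcc (Y j) (Y (j + 1)) = Set.uIcc b.2 y' := by
    have hne := h.neY hj
    have hY : b.2 = Y j ∨ b.2 = Y (j + 1) := by
      rw [hi2]
      rcases hcr with h1 | h1
      · right
        rcases h.succ_eq hi hj h1.symm with h2 | ⟨h2, h3⟩
        · rw [h2]
        · rw [h2, h3, h.cY]
      · left; rw [h.iX' hj hi h1]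
    rcases hY with h1 | h1
    · exact ⟨Y (j + 1), by rw [h1]; exact hne.symm, by rw [h1]⟩
    · exact ⟨Y j, by rw [h1]; exact hne, by rw [h1, Set.uIcc_comm]⟩
  have hd1 : 0 < |x' - b.1| := abs_pos.2 (sub_ne_zero.2 hx')
  have hd2 : 0 < |y' - b.2| := abs_pos.2 (sub_ne_zero.2 hy')
  obtain ⟨e, he, hle⟩ : ∃ e > 0, e ≤ e0 ∧ e ≤ |x' - b.1| ∧ e ≤ |y' - b.2| :=
    ⟨min e0 (min |x' - b.1| |y' - b.2|), by positivity, by simp, by simp, by simp⟩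
  obtain ⟨hle0, hle1, hle2⟩ := hle
  have hB : ∀ p ∈ Box b e, p ∈ BB n X Y ↔
      (p.2 = b.2 ∧ p.1 ∈ Set.uIcc b.1 x') ∨ (p.1 = b.1 ∧ p.2 ∈ Set.uIcc b.2 y') := by
    intro p hp
    constructor
    · intro hpB
      obtain ⟨k, hk, h1 | h1⟩ := hnear p (box_mono hle0 hp) hpB
      · have : k = i := h.iY _ hk _ hi (by rw [← h1.2.1, hi2])
        subst this
        left; exact ⟨by rw [h1.1.1, h1.2.1], ux ▸ h1.1.2⟩
      · have : k = j := h.iX' hk hj (by rw [← h1.2.1, hj1])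
        subst this
        right; exact ⟨by rw [h1.1.1, h1.2.1], uy ▸ h1.1.2⟩
    · rintro (⟨h1, h2⟩ | ⟨h1, h2⟩)
      · exact ⟨i, hi, Or.inl ⟨h1.trans hi2, ux ▸ h2⟩⟩
      · exact ⟨j, hj, Or.inr ⟨h1.trans hj1, uy ▸ h2⟩⟩
  obtain ⟨I, J, pI, pJ, cI, cJ, hIJ, hI, hJ, bI, bJ, hT⟩ := side b.1 x' e he hle1
  obtain ⟨I', J', pI', pJ', cI', cJ', hIJ', hI', hJ', bI', bJ', hT'⟩ := side b.2 y' e he hle2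
  have iI : ∀ y ∈ I, |y - b.1| < e := fun y hy => (hIJ y).2 (Or.inl hy)
  have iJ : ∀ y ∈ J, |y - b.1| < e := fun y hy => (hIJ y).2 (Or.inr (Or.inl hy))
  have iI' : ∀ y ∈ I', |y - b.2| < e := fun y hy => (hIJ' y).2 (Or.inl hy)
  have iJ' : ∀ y ∈ J', |y - b.2| < e := fun y hy => (hIJ' y).2 (Or.inr (Or.inl hy))
  obtain ⟨x0, hx0⟩ := closure_nonempty cI
  obtain ⟨x1, hx1⟩ := closure_nonempty cJ
  obtain ⟨y0, hy0⟩ := closure_nonempty cI'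
  obtain ⟨y1, hy1⟩ := closure_nonempty cJ'
  have key1 : ∀ x, |x - b.1| < e → x ∈ Set.uIcc b.1 x' → x ∈ closure I := by
    intro x h1 h2
    rcases (hIJ _).1 h1 with h3 | h3 | h3
    · exact subset_closure h3
    · exact absurd h2 (hJ _ h3)
    · rw [h3]; exact cI
  have key2 : ∀ x, |x - b.2| < e → x ∈ Set.uIcc b.2 y' → x ∈ closure I' := by
    intro x h1 h2
    rcases (hIJ' _).1 h1 with h3 | h3 | h3
    · exact subset_closure h3
    · exact absurd h2 (hJ' _ h3)
    · rw [h3]; exact cI'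
  have uI : ∀ x ∈ I, x ∈ Set.uIcc b.1 x' := by
    intro x hx; rw [Set.mem_uIcc]
    rcases hI x hx with h4 | h4
    · left; exact ⟨h4.1.le, h4.2.le⟩
    · right; exact ⟨h4.1.le, h4.2.le⟩
  have uI' : ∀ x ∈ I', x ∈ Set.uIcc b.2 y' := by
    intro x hx; rw [Set.mem_uIcc]
    rcases hI' x hx with h4 | h4
    · left; exact ⟨h4.1.le, h4.2.le⟩
    · right; exact ⟨h4.1.le, h4.2.le⟩
  refine ⟨Box b e, I ×ˢ I', (J ×ˢ {x | |x - b.2| < e}) ∪ ({x | |x - b.1| < e} ×ˢ J'), box_open _ _,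
    box_mem _ he, pI.prod pI', ?_, ?_, ?_, ?_, ?_, ?_⟩
  · refine IsPreconnected.union (x1, y1) (Set.mk_mem_prod hx1 (iJ' _ hy1))
      (Set.mk_mem_prod (iJ _ hx1) hy1) ?_ ?_
    · exact pJ.prod (full_pre _ _)
    · exact (full_pre _ _).prod pJ'
  · rintro p ⟨h1, h2⟩ h3
    rcases (hB p ⟨iI _ h1, iI' _ h2⟩).1 h3 with h4 | h4
    · exact bI' (h4.1 ▸ h2)
    · exact bI (h4.1 ▸ h1)
  · rintro p (⟨h1, h2⟩ | ⟨h1, h2⟩) h3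
    · rcases (hB p ⟨iJ _ h1, h2⟩).1 h3 with h4 | h4
      · exact hJ _ h1 h4.2
      · exact bJ (h4.1 ▸ h1)
    · rcases (hB p ⟨h1, iJ' _ h2⟩).1 h3 with h4 | h4
      · exact bJ' (h4.1 ▸ h2)
      · exact hJ' _ h2 h4.2
  · rintro q ⟨h1, h2⟩
    rw [hB q ⟨h1, h2⟩]
    rcases (hIJ _).1 h1 with h3 | h3 | h3
    · rcases (hIJ' _).1 h2 with h4 | h4 | h4
      · right; left; exact ⟨h3, h4⟩
      · right; right; right; exact ⟨h1, h4⟩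
      · left; left; exact ⟨h4, uI _ h3⟩
    · right; right; left; exact ⟨h3, h2⟩
    · rcases (hIJ' _).1 h2 with h4 | h4 | h4
      · left; right; exact ⟨h3, uI' _ h4⟩
      · right; right; right; exact ⟨h1, h4⟩
      · left; right; exact ⟨h3, h4 ▸ Set.left_mem_uIcc⟩
  · intro q hq hqB
    rcases (hB q hq).1 hqB with h4 | h4
    · refine ⟨mem_cl_prod (key1 _ hq.1 h4.2) (h4.1 ▸ cI'), ?_⟩
      exact closure_mono Set.subset_union_right (mem_cl_prod (subset_closure hq.1) (h4.1 ▸ cJ'))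
    · refine ⟨mem_cl_prod (h4.1 ▸ cI) (key2 _ hq.2 h4.2), ?_⟩
      exact closure_mono Set.subset_union_left (mem_cl_prod (h4.1 ▸ cJ) (subset_closure hq.2))
  · refine ⟨(x0, y0), ⟨hx0, hy0⟩, (x0, y1), Or.inr ⟨iI _ hx0, hy1⟩, ?_⟩
    apply par_vtog h hi (bx _ (hI _ hx0)) (hi2 ▸ hT' y0 hy0 y1 hy1)
    intro z hz hzB
    rw [← hi2]
    rcases (hB _ ⟨iI _ hx0, abs_mid (iI' _ hy0) (iJ' _ hy1) hz⟩).1 hzB with h4 | h4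
    · exact h4.1
    · exact absurd hx0 (by have h5 : x0 = b.1 := h4.1
                           rw [h5]; exact bI)

lemma loc (h : Poly n X Y) {b : ℝ × ℝ} (hb : b ∈ BB n X Y) : Loc n X Y b := by
  by_cases hH : ∃ i < n, b ∈ HE X Y i
  · obtain ⟨i, hi, hbi⟩ := hH
    by_cases hV : ∃ i < n, b ∈ VE X Y i
    · obtain ⟨j, hj, hbj⟩ := hV
      exact loc_c h hi hj hbi hbj
    · push Not at hV
      refine loc_h h hi hbi.1 ?_ hV
      have h1 : b.1 ≠ X (i + 1) := by
        intro h0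
        exact hV i hi ⟨h0, hbi.1 ▸ Set.left_mem_uIcc⟩
      have h2 : b.1 ≠ X i := by
        intro h0
        rcases Nat.eq_zero_or_pos i with hi0 | hi0
        · subst hi0
          have e : n - 1 + 1 = n := by omega
          refine hV (n - 1) (by omega) ⟨by rw [e, h.cX, h0], ?_⟩
          rw [e, h.cY, hbi.1]; exact Set.right_mem_uIcc
        · obtain ⟨j, rfl⟩ : ∃ j, i = j + 1 := ⟨i - 1, by omega⟩
          exact hV j (by omega) ⟨h0, hbi.1 ▸ Set.right_mem_uIcc⟩
      have h3 := hbi.2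
      rw [Set.mem_uIcc] at h3
      rcases h3 with h3 | h3
      · left; exact ⟨lt_of_le_of_ne h3.1 h2.symm, lt_of_le_of_ne h3.2 h1⟩
      · right; exact ⟨lt_of_le_of_ne h3.1 h1.symm, lt_of_le_of_ne h3.2 h2⟩
  · push Not at hH
    obtain ⟨i, hi, h1 | hbi⟩ := hb
    · exact absurd h1 (hH i hi)
    refine loc_v h hi hbi.1 ?_ hH
    have h1 : b.2 ≠ Y i := by
      intro h0
      exact hH i hi ⟨h0, hbi.1 ▸ Set.right_mem_uIcc⟩
    have h2 : b.2 ≠ Y (i + 1) := by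
      intro h0
      rcases Nat.lt_or_ge (i + 1) n with hi0 | hi0
      · exact hH (i + 1) hi0 ⟨h0, hbi.1 ▸ Set.left_mem_uIcc⟩
      · have e : i + 1 = n := by omega
        refine hH 0 (by omega) ⟨by rw [h0, e, h.cY], ?_⟩
        rw [hbi.1, e, h.cX]; exact Set.left_mem_uIcc
    have h3 := hbi.2
    rw [Set.mem_uIcc] at h3
    rcases h3 with h3 | h3
    · left; exact ⟨lt_of_le_of_ne h3.1 h1.symm, lt_of_le_of_ne h3.2 h2⟩
    · right; exact ⟨lt_of_le_of_ne h3.1 h2.symm, lt_of_le_of_ne h3.2 h1⟩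

end RP


namespace RP

open Finset

variable {n : ℕ} {X Y : ℕ → ℝ}

lemma HE_pre (i : ℕ) : IsPreconnected (HE X Y i) := by
  have : HE X Y i = Set.uIcc (X i) (X (i + 1)) ×ˢ {Y i} := by
    ext q; simp [HE, and_comm, Set.mem_prod]
  rw [this]
  exact isPreconnected_uIcc.prod isPreconnected_singleton

lemma VE_pre (i : ℕ) : IsPreconnected (VE X Y i) := by
  have : VE X Y i = {X (i + 1)} ×ˢ Set.uIcc (Y i) (Y (i + 1)) := by
    ext q; simp [VE, Set.mem_prod]
  rw [this]
  exact isPreconnected_singleton.prod isPreconnected_uIcc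

lemma BB_pre : IsPreconnected (BB n X Y) := by
  have : BB n X Y = ⋃ i ∈ Set.Iio n, (HE X Y i ∪ VE X Y i) := by
    ext q; simp [BB]
  rw [this]
  refine IsPreconnected.biUnion_of_chain Set.ordConnected_Iio ?_ ?_
  · intro i _
    exact IsPreconnected.union (X (i + 1), Y i) ⟨rfl, Set.right_mem_uIcc⟩
      ⟨rfl, Set.left_mem_uIcc⟩ (HE_pre i) (VE_pre i)
  · intro i _ _
    refine ⟨(X (i + 1), Y (i + 1)), Or.inr ⟨rfl, Set.right_mem_uIcc⟩, Or.inl ?_⟩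
    exact ⟨rfl, Set.left_mem_uIcc⟩

lemma comp_sub {F S : Set (ℝ × ℝ)} {p c : ℝ × ℝ} (hc : c ∈ connectedComponentIn F p) (hcS : c ∈ S)
    (hS : IsPreconnected S) (hSF : S ⊆ F) : S ⊆ connectedComponentIn F p := by
  rw [connectedComponentIn_eq hc]
  exact hS.subset_connectedComponentIn hcS hSF

lemma BB_nonempty (h : Poly n X Y) : (X 0, Y 0) ∈ BB n X Y :=
  ⟨0, by have := h.hn; omega, Or.inl ⟨rfl, Set.left_mem_uIcc⟩⟩

lemma comp_closure (h : Poly n X Y) {p : ℝ × ℝ} (hp : p ∉ BB n X Y) :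
    BB n X Y ⊆ closure (connectedComponentIn (BB n X Y)ᶜ p) := by
  set C := connectedComponentIn (BB n X Y)ᶜ p with hC
  have hCo : IsOpen C := BB_closed.isOpen_compl.connectedComponentIn
  have hCB : C ⊆ (BB n X Y)ᶜ := connectedComponentIn_subset _ _
  have hpC : p ∈ C := mem_connectedComponentIn hp
  have local1 : ∀ b ∈ BB n X Y, b ∈ closure C → ∃ U, IsOpen U ∧ b ∈ U ∧
      ∀ q ∈ U, q ∈ BB n X Y → q ∈ closure C := by
    intro b hb hbC
    obtain ⟨U, P, N, hU, hbU, hP, hN, hPB, hNB, hcov, hcl, -⟩ := loc h hb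
    refine ⟨U, hU, hbU, ?_⟩
    obtain ⟨c, hcU, hcC⟩ := mem_closure_iff.1 hbC U hU hbU
    intro q hq hqB
    rcases hcov c hcU with h1 | h1 | h1
    · exact absurd h1 (hCB hcC)
    · exact closure_mono (comp_sub hcC h1 hP hPB) (hcl q hq hqB).1
    · exact closure_mono (comp_sub hcC h1 hN hNB) (hcl q hq hqB).2
  choose! U hUo hbU hUc using local1
  have hpre := isPreconnected_iff_subset_of_disjoint.1 (BB_pre (n := n) (X := X) (Y := Y))
    (⋃ b ∈ BB n X Y ∩ closure C, U b) (closure C)ᶜ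
    (isOpen_biUnion fun b hb => hUo b hb.1 hb.2) isClosed_closure.isOpen_compl
    (by
      intro b hb
      by_cases hbC : b ∈ closure C
      · left; exact Set.mem_biUnion ⟨hb, hbC⟩ (hbU b hb hbC)
      · right; exact hbC)
    (by
      rw [Set.eq_empty_iff_forall_notMem]
      rintro q ⟨hq, hq1, hq2⟩
      simp only [Set.mem_iUnion] at hq1
      obtain ⟨b, hb, hqb⟩ := hq1
      exact hq2 (hUc b hb.1 hb.2 q hqb hq))
  rcases hpre with h1 | h1
  · intro q hq
    have hq1 := h1 hq
    simp only [Set.mem_iUnion] at hq1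
    obtain ⟨b, hb, hqb⟩ := hq1
    exact hUc b hb.1 hb.2 q hqb hq
  · exfalso
    have hclosed : IsClosed C := by
      rw [← closure_subset_iff_isClosed]
      intro x hx
      have hxB : x ∉ BB n X Y := fun h0 => h1 h0 hx
      obtain ⟨c, hc1, hc2⟩ := mem_closure_iff.1 hx (connectedComponentIn (BB n X Y)ᶜ x)
        BB_closed.isOpen_compl.connectedComponentIn (mem_connectedComponentIn hxB)
      have e1 := connectedComponentIn_eq hc1
      have e2 := connectedComponentIn_eq hc2
      rw [hC, e2, ← e1]
      exact mem_connectedComponentIn hxB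
    have := IsClopen.eq_univ ⟨hclosed, hCo⟩ ⟨p, hpC⟩
    exact hCB (this ▸ Set.mem_univ (X 0, Y 0)) (BB_nonempty h)

lemma comp_par (h : Poly n X Y) {p q : ℝ × ℝ}
    (hq : q ∈ connectedComponentIn (BB n X Y)ᶜ p) : par n X Y q = par n X Y p := by
  have hp : p ∈ (BB n X Y)ᶜ := connectedComponentIn_nonempty_iff.1 ⟨q, hq⟩
  exact isPreconnected_connectedComponentIn.constant
    ((par_cont h).mono (connectedComponentIn_subset _ _)) hq (mem_connectedComponentIn hp)

lemma comp_eq (h : Poly n X Y) {p q : ℝ × ℝ} (hp : p ∉ BB n X Y) (hq : q ∉ BB n X Y)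
    (hpq : par n X Y p = par n X Y q) :
    connectedComponentIn (BB n X Y)ᶜ p = connectedComponentIn (BB n X Y)ᶜ q := by
  obtain ⟨U, P, N, hU, hbU, hP, hN, hPB, hNB, hcov, hcl, x, hx, y, hy, hxy⟩ := loc h (BB_nonempty h)
  have key : ∀ p, p ∉ BB n X Y → x ∈ connectedComponentIn (BB n X Y)ᶜ p ∨
      y ∈ connectedComponentIn (BB n X Y)ᶜ p := by
    intro p hp
    obtain ⟨c, hcU, hcC⟩ := mem_closure_iff.1 (comp_closure h hp (BB_nonempty h)) U hU hbU
    rcases hcov c hcU with h1 | h1 | h1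
    · exact absurd h1 (connectedComponentIn_subset _ _ hcC)
    · left; exact comp_sub hcC h1 hP hPB hx
    · right; exact comp_sub hcC h1 hN hNB hy
  have z : ∀ a b : ZMod 2, a + b = 1 → a ≠ b := by decide
  have hne := z _ _ hxy
  rcases key p hp with h1 | h1 <;> rcases key q hq with h2 | h2
  · rw [connectedComponentIn_eq h1, connectedComponentIn_eq h2]
  · exact absurd ((comp_par h h1).trans (hpq.trans (comp_par h h2).symm)) hne
  · exact absurd ((comp_par h h2).trans (hpq.symm.trans (comp_par h h1).symm)) hne
  · rw [connectedComponentIn_eq h1, connectedComponentIn_eq h2]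

lemma jordan (h : Poly n X Y) : RR n X Y =
    BB n X Y ∪ {p | Bornology.IsBounded (connectedComponentIn (BB n X Y)ᶜ p)} := by
  obtain ⟨M, hM, hXM⟩ := exists_bound n X
  obtain ⟨M', hM', hYM⟩ := exists_bound n Y
  have hn := h.hn
  ext q
  by_cases hq : q ∈ BB n X Y
  · simp [RR, hq]
  have e : q ∈ RR n X Y ↔ par n X Y q = 1 := by simp [RR, hq]
  rw [e]
  have e2 : q ∈ BB n X Y ∪ {p | Bornology.IsBounded (connectedComponentIn (BB n X Y)ᶜ p)} ↔
    Bornology.IsBounded (connectedComponentIn (BB n X Y)ᶜ q) := by simp [hq]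
  rw [e2]
  constructor
  · intro h1
    apply (Metric.isBounded_Icc ((-M, -M') : ℝ × ℝ) (M, M')).subset
    intro p hp
    have h2 := comp_par h hp
    rw [h1] at h2
    have a1 : -M ≤ p.1 := by
      by_contra h0
      have := par_left h (p := p) (fun i hi => by have := abs_lt.1 (hXM i hi.le); linarith)
      rw [this] at h2; exact absurd h2 (by decide)
    have a2 : p.1 ≤ M := by
      by_contra h0
      have := par_right h (p := p) (fun i hi => by have := abs_lt.1 (hXM i hi.le); linarith)
      rw [this] at h2; exact absurd h2 (by decide)
    have a3 : -M' ≤ p.2 := by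
      by_contra h0
      have := par_bot h (p := p) (fun i hi => by have := abs_lt.1 (hYM i hi.le); linarith)
      rw [this] at h2; exact absurd h2 (by decide)
    have a4 : p.2 ≤ M' := by
      by_contra h0
      have := par_top (n := n) (X := X) (Y := Y) (p := p) (fun i hi => by have := abs_lt.1 (hYM i hi.le); linarith)
      rw [this] at h2; exact absurd h2 (by decide)
    exact ⟨⟨a1, a3⟩, ⟨a2, a4⟩⟩
  · intro hb
    rcases z2 (par n X Y q) with h1 | h1
    swap
    · exact h1
    exfalso
    have hline : Set.univ ×ˢ {M'} ⊆ (BB n X Y)ᶜ := by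
      rintro ⟨x, y⟩ ⟨-, hy⟩ ⟨i, hi, h2 | h2⟩
      · have h3 : y = M' := hy
        have h4 : y = Y i := h2.1
        have := abs_lt.1 (hYM i hi.le)
        linarith
      · have h3 : y = M' := hy
        have h4 := h2.2
        have a := abs_lt.1 (hYM i hi.le)
        have b := abs_lt.1 (hYM (i + 1) hi)
        rw [Set.mem_uIcc] at h4
        rcases h4 with h4 | h4 <;> simp only at h4 <;> linarith
    have hf : ((0 : ℝ), M') ∈ (Set.univ ×ˢ {M'} : Set (ℝ × ℝ)) := ⟨trivial, rfl⟩
    have hpar : par n X Y (0, M') = 0 := par_top fun i hi => (abs_lt.1 (hYM i hi.le)).2.le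
    have hce := comp_eq h hq (hline hf) (h1.trans hpar.symm)
    have hsub : (Set.univ ×ˢ {M'} : Set (ℝ × ℝ)) ⊆ connectedComponentIn (BB n X Y)ᶜ q := by
      rw [hce]
      exact (isPreconnected_univ.prod isPreconnected_singleton).subset_connectedComponentIn hf hline
    obtain ⟨K, hK⟩ := (hb.subset hsub).exists_norm_le
    have := hK (|K| + 1, M') ⟨trivial, rfl⟩
    rw [Prod.norm_def] at this
    have h5 := (le_max_left _ _).trans this
    simp only [Real.norm_eq_abs] at h5
    have h6 := le_abs_self (|K| + 1)
    have h7 := le_abs_self K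
    linarith

end RP


namespace RP

open Finset

variable {n k : ℕ} {X Y : ℕ → ℝ}

/-- x-coordinates of the second piece -/
def X2 (k : ℕ) (X : ℕ → ℝ) (i : ℕ) : ℝ := if i = 0 then X (k + 1) else X i
/-- y-coordinates of the second piece -/
def Y2 (k : ℕ) (Y : ℕ → ℝ) (i : ℕ) : ℝ := if i = k + 1 then Y 0 else Y i
/-- coordinates of the first piece -/
def Z1 (k : ℕ) (X : ℕ → ℝ) (i : ℕ) : ℝ := if i = 0 then X 0 else X (i + k)

lemma X2z : X2 k X 0 = X (k + 1) := by simp [X2]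
lemma X2s (i : ℕ) : X2 k X (i + 1) = X (i + 1) := by simp [X2]
lemma Y2k : Y2 k Y (k + 1) = Y 0 := by simp [Y2]
lemma Y2l {i : ℕ} (h : i ≤ k) : Y2 k Y i = Y i := by
  unfold Y2; rw [if_neg (by omega)]
lemma Z1z : Z1 k X 0 = X 0 := by simp [Z1]
lemma Z1s (i : ℕ) : Z1 k X (i + 1) = X (i + 1 + k) := by simp [Z1]

/-- an interior chord extending edge 0 -/
structure Chord (n k : ℕ) (X Y : ℕ → ℝ) : Prop where
  k1 : 1 ≤ k
  k2 : k + 2 ≤ n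
  bx : Btw (X 0) (X 1) (X (k + 1))
  bY : Btw (Y k) (Y 0) (Y (k + 1))
  free : ∀ x, Btw (X 1) x (X (k + 1)) → (x, Y 0) ∉ BB n X Y ∧ par n X Y (x, Y 0) = 1

/-- the closed chord -/
def CC (k : ℕ) (X Y : ℕ → ℝ) : Set (ℝ × ℝ) :=
  {q | q.2 = Y 0 ∧ q.1 ∈ Set.uIcc (X 1) (X (k + 1))}

lemma uIcc_cases {a b x : ℝ} (h : x ∈ Set.uIcc a b) : x = a ∨ x = b ∨ Btw a x b := by
  rw [Set.mem_uIcc] at h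
  unfold Btw
  grind

lemma Btw.mem {a b x : ℝ} (h : Btw a x b) : x ∈ Set.uIcc a b := by
  rw [Set.mem_uIcc]
  unfold Btw at h
  grind

lemma uIcc_sub_left {a b c : ℝ} (h : Btw a c b) {x : ℝ} (hx : x ∈ Set.uIcc a c) :
    x ∈ Set.uIcc a b := by
  rw [Set.mem_uIcc] at *
  unfold Btw at h
  grind

lemma uIcc_sub_right {a b c : ℝ} (h : Btw a c b) {x : ℝ} (hx : x ∈ Set.uIcc c b) :
    x ∈ Set.uIcc a b := by
  rw [Set.mem_uIcc] at *
  unfold Btw at h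
  grind

lemma uIcc_split {a b c : ℝ} (h : Btw a c b) {x : ℝ} (hx : x ∈ Set.uIcc a b) :
    x ∈ Set.uIcc a c ∨ x ∈ Set.uIcc c b := by
  rw [Set.mem_uIcc] at *
  rw [Set.mem_uIcc]
  unfold Btw at h
  grind

lemma uIcc_inter {a b c : ℝ} (h : Btw a c b) {x : ℝ} (hx : x ∈ Set.uIcc a c)
    (hx' : x ∈ Set.uIcc c b) : x = c := by
  rw [Set.mem_uIcc] at *
  unfold Btw at h
  grind

lemma uIcc_not {a b c : ℝ} (hc : c ∈ Set.uIcc a b) (h : c ≠ a) {x : ℝ} (hx : x ∈ Set.uIcc c b) :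
    x ≠ a := by
  rw [Set.mem_uIcc] at *
  grind

/-- vertical edges meeting the chord -/
lemma chord_v (h : Poly n X Y) (c : Chord n k X Y) {j : ℕ} (hj : j < n) (h1 : X (j + 1) ∈ Set.uIcc (X 1) (X (k + 1)))
    (h2 : Y 0 ∈ Set.uIcc (Y j) (Y (j + 1))) : j = 0 ∨ j = k := by
  have := c.k1
  have := c.k2
  rcases uIcc_cases h1 with h3 | h3 | h3
  · left; exact h.iX' hj (by omega) h3
  · right; exact h.iX' hj (by omega) h3
  · exact absurd ⟨j, hj, Or.inr ⟨rfl, h2⟩⟩ (c.free _ h3).1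

lemma poly2 (h : Poly n X Y) (c : Chord n k X Y) : Poly (k + 1) (X2 k X) (Y2 k Y) := by
  have := c.k1
  have := c.k2
  refine ⟨by omega, by rw [X2s, X2z], by rw [Y2k, Y2l (by omega)], ?_, ?_, ?_⟩
  · intro i hi j hj e
    rcases i with _ | i <;> rcases j with _ | j
    · rfl
    · rw [X2z, X2s] at e
      have := h.iX _ (by omega) _ (by omega) e; omega
    · rw [X2z, X2s] at e
      have := h.iX _ (by omega) _ (by omega) e; omega
    · rw [X2s, X2s] at e
      have := h.iX _ (by omega) _ (by omega) e; omega
  · intro i hi j hj e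
    rw [Y2l (by omega), Y2l (by omega)] at e
    exact h.iY _ (by omega) _ (by omega) e
  · intro i hi j hj h1 h2
    rw [X2s] at h1 ⊢
    rw [X2s] at h1 ⊢
    rw [Y2l (by omega : i ≤ k)] at h2
    have h2' : Y i ∈ Set.uIcc (Y j) (Y (j + 1)) := by
      rw [Y2l (by omega : j ≤ k)] at h2
      rcases Nat.lt_or_ge j k with h3 | h3
      · rwa [Y2l (by omega)] at h2
      · have : j = k := by omega
        subst this
        rw [Y2k] at h2
        exact uIcc_sub_left c.bY h2
    rcases i with _ | i
    · rw [X2z] at h1 ⊢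
      rw [Set.uIcc_comm] at h1
      rcases chord_v h c (by omega) h1 h2' with h3 | h3
      · right; rw [h3]
      · left; rw [h3]
    · rw [X2s] at h1 ⊢
      exact h.cross _ (by omega) _ (by omega) h1 h2'

lemma poly1 (h : Poly n X Y) (c : Chord n k X Y) : Poly (n - k) (Z1 k X) (Z1 k Y) := by
  have := c.k1
  have := c.k2
  obtain ⟨m, rfl⟩ : ∃ m, n = k + 1 + m + 1 := ⟨n - k - 2, by omega⟩
  have e0 : k + 1 + m + 1 - k = m + 1 + 1 := by omega
  rw [e0]
  have e1 : m + 1 + 1 + k = k + 1 + m + 1 := by omega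
  refine ⟨by omega, by rw [Z1s, Z1z, e1, h.cX], by rw [Z1s, Z1z, e1, h.cY], ?_, ?_, ?_⟩
  · intro i hi j hj e
    rcases i with _ | i <;> rcases j with _ | j
    · rfl
    · rw [Z1z, Z1s] at e
      have := h.iX _ (by omega) _ (by omega) e; omega
    · rw [Z1z, Z1s] at e
      have := h.iX _ (by omega) _ (by omega) e; omega
    · rw [Z1s, Z1s] at e
      have := h.iX _ (by omega) _ (by omega) e; omega
  · intro i hi j hj e
    rcases i with _ | i <;> rcases j with _ | j
    · rfl
    · rw [Z1z, Z1s] at e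
      have := h.iY _ (by omega) _ (by omega) e; omega
    · rw [Z1z, Z1s] at e
      have := h.iY _ (by omega) _ (by omega) e; omega
    · rw [Z1s, Z1s] at e
      have := h.iY _ (by omega) _ (by omega) e; omega
  · intro i hi j hj h1 h2
    rw [Z1s] at h1 ⊢
    rw [Z1s] at h1 ⊢
    have h2' : Z1 k Y i ∈ Set.uIcc (Y (j + k)) (Y (j + k + 1)) := by
      rw [Z1s] at h2
      have e2 : j + 1 + k = j + k + 1 := by omega
      rw [e2] at h2
      rcases j with _ | j
      · rw [Z1z] at h2
        have := uIcc_sub_right c.bY (x := Z1 k Y i) (by simpa using h2)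
        simpa using this
      · rwa [Z1s] at h2
    have e2 : j + 1 + k = j + k + 1 := by omega
    rw [e2] at h1 ⊢
    rcases i with _ | i
    · rw [Z1z] at h1 h2' ⊢
      have e3 : 0 + 1 + k = k + 1 := by omega
      rw [e3] at h1 ⊢
      rcases uIcc_split c.bx h1 with h3 | h3
      · rcases h.cross 0 (by omega) (j + k) (by omega) h3 h2' with h4 | h4
        · left; exact h4
        · have := h.iX' (i := j + k) (j := 0) (by omega) (by omega) h4
          omega
      · rcases chord_v h c (by omega) h3 h2' with h4 | h4
        · omega
        · right; rw [h4]
    · rw [Z1s] at h1 h2' ⊢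
      have e3 : i + 1 + 1 + k = i + 1 + k + 1 := by omega
      rw [e3] at h1 ⊢
      exact h.cross _ (by omega) _ (by omega) h1 h2'

lemma par_add (h : Poly n X Y) (c : Chord n k X Y) (p : ℝ × ℝ) :
    par n X Y p = par (n - k) (Z1 k X) (Z1 k Y) p + par (k + 1) (X2 k X) (Y2 k Y) p := by
  have := c.k1
  have := c.k2
  obtain ⟨m, rfl⟩ : ∃ m, n = k + 1 + m := ⟨n - k - 1, by omega⟩
  have e0 : k + 1 + m - k = m + 1 := by omega
  unfold par
  rw [e0, Finset.sum_range_add, Finset.sum_range_succ', Finset.sum_range_succ' _ m,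
    Finset.sum_range_succ' _ k]
  have s1 : ∑ i ∈ range m, (hX (X (k + 1 + i)) p.1 + hX (X (k + 1 + i + 1)) p.1) * gY (Y (k + 1 + i)) p.2
     = ∑ i ∈ range m, (hX (Z1 k X (i + 1)) p.1 + hX (Z1 k X (i + 1 + 1)) p.1) * gY (Z1 k Y (i + 1)) p.2 := by
    apply Finset.sum_congr rfl
    intro i hi
    rw [Z1s, Z1s, Z1s]
    have e1 : k + 1 + i = i + 1 + k := by omega
    have e2 : k + 1 + i + 1 = i + 1 + 1 + k := by omega
    rw [e2, e1]
  have s2 : ∑ i ∈ range k, (hX (X2 k X (i + 1)) p.1 + hX (X2 k X (i + 1 + 1)) p.1) * gY (Y2 k Y (i + 1)) p.2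
      = ∑ i ∈ range k, (hX (X (i + 1)) p.1 + hX (X (i + 1 + 1)) p.1) * gY (Y (i + 1)) p.2 := by
    apply Finset.sum_congr rfl
    intro i hi
    have : i < k := by simpa using hi
    rw [X2s, X2s, Y2l (by omega)]
  rw [s1, s2, X2z, X2s, Y2l (by omega), Z1z, Z1s, Z1z]
  have e1 : 0 + 1 + k = k + 1 := by omega
  rw [e1]
  have : ∀ A B x y z g : ZMod 2, A + (x + y) * g + B = B + (x + z) * g + (A + (z + y) * g) := by
    decide
  exact this _ _ _ _ _ _

/-- classification of the edges of the second piece -/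
lemma mem_B2 (h : Poly n X Y) (c : Chord n k X Y) {q : ℝ × ℝ} : q ∈ BB (k + 1) (X2 k X) (Y2 k Y) ↔ q ∈ CC k X Y ∨
    (∃ i, 1 ≤ i ∧ i ≤ k ∧ q ∈ HE X Y i) ∨ (∃ i < k, q ∈ VE X Y i) ∨
    (q.1 = X (k + 1) ∧ q.2 ∈ Set.uIcc (Y k) (Y 0)) := by
  constructor
  · rintro ⟨i, hi, ⟨h1, h2⟩ | ⟨h1, h2⟩⟩
    · rcases i with _ | i
      · left
        rw [X2z, X2s, Set.uIcc_comm] at h2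
        rw [Y2l (by omega)] at h1
        exact ⟨h1, h2⟩
      · right; left
        rw [X2s, X2s] at h2
        rw [Y2l (by omega)] at h1
        exact ⟨i + 1, by omega, by omega, h1, h2⟩
    · right; right
      rw [X2s] at h1
      rcases Nat.lt_or_ge i k with h3 | h3
      · left; rw [Y2l (by omega), Y2l (by omega)] at h2
        exact ⟨i, h3, h1, h2⟩
      · right
        have : i = k := by omega
        subst this
        rw [Y2k, Y2l le_rfl] at h2
        exact ⟨h1, h2⟩
  · rintro (⟨h1, h2⟩ | ⟨i, hi, hik, h1, h2⟩ | ⟨i, hi, h1, h2⟩ | ⟨h1, h2⟩)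
    · refine ⟨0, by omega, Or.inl ⟨?_, ?_⟩⟩
      · rw [Y2l (by omega)]; exact h1
      · rw [X2z, X2s, Set.uIcc_comm]; exact h2
    · obtain ⟨j, rfl⟩ : ∃ j, i = j + 1 := ⟨i - 1, by omega⟩
      refine ⟨j + 1, by omega, Or.inl ⟨?_, ?_⟩⟩
      · rw [Y2l (by omega)]; exact h1
      · rw [X2s, X2s]; exact h2
    · refine ⟨i, by omega, Or.inr ⟨?_, ?_⟩⟩
      · rw [X2s]; exact h1
      · rw [Y2l (by omega), Y2l (by omega)]; exact h2
    · refine ⟨k, by omega, Or.inr ⟨?_, ?_⟩⟩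
      · rw [X2s]; exact h1
      · rw [Y2l (by omega), Y2k]; exact h2

/-- classification of the edges of the first piece -/
lemma mem_B1 (h : Poly n X Y) (c : Chord n k X Y) {q : ℝ × ℝ} : q ∈ BB (n - k) (Z1 k X) (Z1 k Y) ↔ q ∈ CC k X Y ∨ q ∈ HE X Y 0 ∨
    (∃ i, k < i ∧ i < n ∧ q ∈ HE X Y i) ∨ (∃ i, k < i ∧ i < n ∧ q ∈ VE X Y i) ∨
    (q.1 = X (k + 1) ∧ q.2 ∈ Set.uIcc (Y 0) (Y (k + 1))) := by
  have hk1 := c.k1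
  have hk2 := c.k2
  constructor
  · rintro ⟨i, hi, ⟨h1, h2⟩ | ⟨h1, h2⟩⟩
    · rcases i with _ | i
      · rw [Z1z, Z1s, show 0 + 1 + k = k + 1 by omega] at h2
        rw [Z1z] at h1
        rcases uIcc_split c.bx h2 with h3 | h3
        · right; left; exact ⟨h1, h3⟩
        · left; exact ⟨h1, h3⟩
      · right; right; left
        rw [Z1s, Z1s, show i + 1 + 1 + k = i + 1 + k + 1 by omega] at h2
        rw [Z1s] at h1
        exact ⟨i + 1 + k, by omega, by omega, h1, h2⟩
    · right; right; right
      rw [Z1s, show i + 1 + k = i + k + 1 by omega] at h1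
      rw [Z1s] at h2
      rcases i with _ | i
      · right; rw [Z1z, show 0 + 1 + k = k + 1 by omega] at h2
        rw [show 0 + k + 1 = k + 1 by omega] at h1
        exact ⟨h1, h2⟩
      · left; rw [Z1s, show i + 1 + 1 + k = i + 1 + k + 1 by omega] at h2
        exact ⟨i + 1 + k, by omega, by omega, h1, h2⟩
  · rintro (⟨h1, h2⟩ | ⟨h1, h2⟩ | ⟨i, hi, hik, h1, h2⟩ | ⟨i, hi, hik, h1, h2⟩ | ⟨h1, h2⟩)
    · refine ⟨0, by omega, Or.inl ⟨?_, ?_⟩⟩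
      · rw [Z1z]; exact h1
      · rw [Z1z, Z1s, show 0 + 1 + k = k + 1 by omega]; exact uIcc_sub_right c.bx h2
    · refine ⟨0, by omega, Or.inl ⟨?_, ?_⟩⟩
      · rw [Z1z]; exact h1
      · rw [Z1z, Z1s, show 0 + 1 + k = k + 1 by omega]; exact uIcc_sub_left c.bx h2
    · obtain ⟨j, rfl⟩ : ∃ j, i = j + 1 + k := ⟨i - 1 - k, by omega⟩
      refine ⟨j + 1, by omega, Or.inl ⟨?_, ?_⟩⟩
      · rw [Z1s]; exact h1
      · rw [Z1s, Z1s, show j + 1 + 1 + k = j + 1 + k + 1 by omega]; exact h2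
    · obtain ⟨j, rfl⟩ : ∃ j, i = j + 1 + k := ⟨i - 1 - k, by omega⟩
      refine ⟨j + 1, by omega, Or.inr ⟨?_, ?_⟩⟩
      · rw [Z1s, show j + 1 + 1 + k = j + 1 + k + 1 by omega]; exact h1
      · rw [Z1s, Z1s, show j + 1 + 1 + k = j + 1 + k + 1 by omega]; exact h2
    · refine ⟨0, by omega, Or.inr ⟨?_, ?_⟩⟩
      · rw [Z1s, show 0 + 1 + k = k + 1 by omega]; exact h1
      · rw [Z1z, Z1s, show 0 + 1 + k = k + 1 by omega]; exact h2

lemma B_sub (h : Poly n X Y) (c : Chord n k X Y) {q : ℝ × ℝ} (hq : q ∈ BB n X Y) :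
    q ∈ BB (n - k) (Z1 k X) (Z1 k Y) ∨ q ∈ BB (k + 1) (X2 k X) (Y2 k Y) := by
  rw [mem_B1 h c, mem_B2 h c]
  have hk1 := c.k1
  obtain ⟨i, hi, h1 | h1⟩ := hq
  · rcases Nat.eq_zero_or_pos i with h2 | h2
    · subst h2; left; right; left; exact h1
    · rcases Nat.lt_or_ge k i with h3 | h3
      · left; right; right; left; exact ⟨i, h3, hi, h1⟩
      · right; right; left; exact ⟨i, h2, h3, h1⟩
  · rcases lt_trichotomy i k with h3 | h3 | h3
    · right; right; right; left; exact ⟨i, h3, h1⟩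
    · subst h3
      rcases uIcc_split c.bY h1.2 with h4 | h4
      · right; right; right; right; exact ⟨h1.1, h4⟩
      · left; right; right; right; right; exact ⟨h1.1, h4⟩
    · left; right; right; right; left; exact ⟨i, h3, hi, h1⟩

lemma B1_sub (h : Poly n X Y) (c : Chord n k X Y) {q : ℝ × ℝ} (hq : q ∈ BB (n - k) (Z1 k X) (Z1 k Y)) :
    q ∈ BB n X Y ∨ q ∈ CC k X Y := by
  have := c.k2
  rw [mem_B1 h c] at hq
  rcases hq with h1 | h1 | ⟨i, _, hi, h1⟩ | ⟨i, _, hi, h1⟩ | ⟨h1, h2⟩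
  · right; exact h1
  · left; exact ⟨0, by omega, Or.inl h1⟩
  · left; exact ⟨i, by omega, Or.inl h1⟩
  · left; exact ⟨i, by omega, Or.inr h1⟩
  · left; exact ⟨k, by omega, Or.inr ⟨h1, uIcc_sub_right c.bY h2⟩⟩

lemma B2_sub (h : Poly n X Y) (c : Chord n k X Y) {q : ℝ × ℝ} (hq : q ∈ BB (k + 1) (X2 k X) (Y2 k Y)) :
    q ∈ BB n X Y ∨ q ∈ CC k X Y := by
  have := c.k2
  rw [mem_B2 h c] at hq
  rcases hq with h1 | ⟨i, _, hi, h1⟩ | ⟨i, hi, h1⟩ | ⟨h1, h2⟩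
  · right; exact h1
  · left; exact ⟨i, by omega, Or.inl h1⟩
  · left; exact ⟨i, by omega, Or.inr h1⟩
  · left; exact ⟨k, by omega, Or.inr ⟨h1, uIcc_sub_left c.bY h2⟩⟩

/-- intersections of a horizontal and a vertical edge of the polygon -/
lemma hv (h : Poly n X Y) {i j : ℕ} {q : ℝ × ℝ} (hi : i < n) (hj : j < n) (h1 : q ∈ HE X Y i) (h2 : q ∈ VE X Y j) :
    i = j ∨ i = j + 1 ∨ (i = 0 ∧ j + 1 = n) := by
  rcases h.cross i hi j hj (h2.1 ▸ h1.2) (h1.1 ▸ h2.2) with h3 | h3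
  · right; exact h.succ_eq hi hj h3.symm
  · left; exact (h.iX' hj hi h3).symm

lemma B12 (h : Poly n X Y) (c : Chord n k X Y) {q : ℝ × ℝ} (h1 : q ∈ BB (n - k) (Z1 k X) (Z1 k Y))
    (h2 : q ∈ BB (k + 1) (X2 k X) (Y2 k Y)) : q ∈ CC k X Y := by
  have hk1 := c.k1
  have hk2 := c.k2
  have hp : ∀ y ∈ Set.uIcc (Y k) (Y 0), y ∈ Set.uIcc (Y k) (Y (k + 1)) :=
    fun y hy => uIcc_sub_left c.bY hy
  have hp' : ∀ y ∈ Set.uIcc (Y 0) (Y (k + 1)), y ∈ Set.uIcc (Y k) (Y (k + 1)) :=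
    fun y hy => uIcc_sub_right c.bY hy
  have hne0 : Y (k + 1) ≠ Y 0 := by rcases c.bY with h | h <;> intro e <;> linarith [h.1, h.2]
  have hne1 : Y k ≠ Y 0 := by rcases c.bY with h | h <;> intro e <;> linarith [h.1, h.2]
  rw [mem_B1 h c] at h1
  rw [mem_B2 h c] at h2
  rcases h2 with h2 | ⟨j, hj1, hj, h2⟩ | ⟨j, hj, h2⟩ | ⟨h2, h2'⟩
  · exact h2
  · rcases h1 with h1 | h1 | ⟨i, hki, hi, h1⟩ | ⟨i, hki, hi, h1⟩ | ⟨h1, h1'⟩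
    · exact h1
    · have := h.iY 0 (by omega) j (by omega) (by rw [← h1.1, ← h2.1]); omega
    · have := h.iY i (by omega) j (by omega) (by rw [← h1.1, ← h2.1]); omega
    · have := hv h (by omega) (by omega) h2 h1; omega
    · have h3 := hv h (by omega) (by omega) h2 (j := k) ⟨h1, hp' _ h1'⟩
      have : j = k := by omega
      subst this
      rw [h2.1] at h1'
      exact absurd (uIcc_inter c.bY Set.left_mem_uIcc h1') hne1
  · rcases h1 with h1 | h1 | ⟨i, hki, hi, h1⟩ | ⟨i, hki, hi, h1⟩ | ⟨h1, h1'⟩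
    · exact h1
    · have := hv h (by omega) (by omega) h1 h2
      have : j = 0 := by omega
      subst this
      exact ⟨h1.1, by rw [h2.1]; exact Set.left_mem_uIcc⟩
    · have := hv h (by omega) (by omega) h1 h2; omega
    · have := h.iX' (i := i) (j := j) (by omega) (by omega) (by rw [← h1.1, ← h2.1]); omega
    · have := h.iX' (i := k) (j := j) (by omega) (by omega) (by rw [← h1, ← h2.1]); omega
  · rcases h1 with h1 | h1 | ⟨i, hki, hi, h1⟩ | ⟨i, hki, hi, h1⟩ | ⟨h1, h1'⟩
    · exact h1
    · have := hv h (by omega) (by omega) h1 (j := k) ⟨h2, hp _ h2'⟩; omega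
    · have := hv h (by omega) (by omega) h1 (j := k) ⟨h2, hp _ h2'⟩
      have : i = k + 1 := by omega
      subst this
      rw [h1.1] at h2'
      exact absurd (uIcc_inter c.bY h2' Set.right_mem_uIcc) hne0
    · have := h.iX' (i := i) (j := k) (by omega) (by omega) (by rw [← h1.1, ← h2]); omega
    · exact ⟨uIcc_inter c.bY h2' h1', by rw [h1]; exact Set.right_mem_uIcc⟩

end RP


namespace RP

open Finset

variable {n k : ℕ} {X Y : ℕ → ℝ}

/-- boundary of the first piece -/
abbrev A1 (n k : ℕ) (X Y : ℕ → ℝ) : Set (ℝ × ℝ) := BB (n - k) (Z1 k X) (Z1 k Y)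
/-- boundary of the second piece -/
abbrev A2 (k : ℕ) (X Y : ℕ → ℝ) : Set (ℝ × ℝ) := BB (k + 1) (X2 k X) (Y2 k Y)
/-- parity of the first piece -/
noncomputable abbrev p1 (n k : ℕ) (X Y : ℕ → ℝ) : ℝ × ℝ → ZMod 2 := par (n - k) (Z1 k X) (Z1 k Y)
/-- parity of the second piece -/
noncomputable abbrev p2 (k : ℕ) (X Y : ℕ → ℝ) : ℝ × ℝ → ZMod 2 := par (k + 1) (X2 k X) (Y2 k Y)

lemma s2v (h : Poly n X Y) (c : Chord n k X Y) {s t t' : ℝ}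
    (hB : ∀ y ∈ Set.uIcc t t', (s, y) ∈ A2 k X Y ∧ (s, y) ∉ CC k X Y) :
    p1 n k X Y (s, t) = p1 n k X Y (s, t') :=
  par_vmove fun y hy h1 => (hB y hy).2 (B12 h c h1 (hB y hy).1)

lemma s2h (h : Poly n X Y) (c : Chord n k X Y) {s s' t : ℝ}
    (hB : ∀ x ∈ Set.uIcc s s', (x, t) ∈ A2 k X Y ∧ (x, t) ∉ CC k X Y) :
    p1 n k X Y (s, t) = p1 n k X Y (s', t) :=
  par_hmove (poly1 h c) fun y hy h1 => (hB y hy).2 (B12 h c h1 (hB y hy).1)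

lemma s1v (h : Poly n X Y) (c : Chord n k X Y) {s t t' : ℝ}
    (hB : ∀ y ∈ Set.uIcc t t', (s, y) ∈ A1 n k X Y ∧ (s, y) ∉ CC k X Y) :
    p2 k X Y (s, t) = p2 k X Y (s, t') :=
  par_vmove fun y hy h1 => (hB y hy).2 (B12 h c (hB y hy).1 h1)

lemma s1h (h : Poly n X Y) (c : Chord n k X Y) {s s' t : ℝ}
    (hB : ∀ x ∈ Set.uIcc s s', (x, t) ∈ A1 n k X Y ∧ (x, t) ∉ CC k X Y) :
    p2 k X Y (s, t) = p2 k X Y (s', t) :=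
  par_hmove (poly2 h c) fun y hy h1 => (hB y hy).2 (B12 h c (hB y hy).1 h1)

lemma S2H (h : Poly n X Y) (c : Chord n k X Y) {i : ℕ} (i1 : 1 ≤ i) (i2 : i ≤ k) {s s' : ℝ}
    (hs : s ∈ Set.uIcc (X i) (X (i + 1))) (hs' : s' ∈ Set.uIcc (X i) (X (i + 1))) :
    p1 n k X Y (s, Y i) = p1 n k X Y (s', Y i) := by
  have := c.k2
  refine s2h h c fun x hx => ⟨?_, ?_⟩
  · rw [mem_B2 h c]
    right; left; exact ⟨i, i1, i2, rfl, Set.uIcc_subset_uIcc hs hs' hx⟩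
  · rintro ⟨e, _⟩
    have := h.iY i (by omega) 0 (by omega) e
    omega

lemma S2V (h : Poly n X Y) (c : Chord n k X Y) {i : ℕ} (i1 : 1 ≤ i) (i2 : i < k) {s s' : ℝ}
    (hs : s ∈ Set.uIcc (Y i) (Y (i + 1))) (hs' : s' ∈ Set.uIcc (Y i) (Y (i + 1))) :
    p1 n k X Y (X (i + 1), s) = p1 n k X Y (X (i + 1), s') := by
  have := c.k2
  refine s2v h c fun y hy => ⟨?_, ?_⟩
  · rw [mem_B2 h c]
    right; right; left; exact ⟨i, i2, rfl, Set.uIcc_subset_uIcc hs hs' hy⟩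
  · rintro ⟨e, e'⟩
    have h3 := Set.uIcc_subset_uIcc hs hs' hy
    simp only at e e'
    rw [e] at h3
    have := chord_v h c (j := i) (by omega) e' h3
    omega

lemma S2W (h : Poly n X Y) (c : Chord n k X Y) (i : ℕ) (i2 : i + 1 ≤ k) :
    p1 n k X Y (X (i + 1), Y (i + 1)) = p1 n k X Y (X 1, Y 1) := by
  induction i with
  | zero => rfl
  | succ i ih =>
    rw [← ih (by omega), S2H h c (i := i + 1) (by omega) (by omega) (s := X (i + 1))
      (s' := X (i + 1 + 1)) Set.left_mem_uIcc Set.right_mem_uIcc]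
    exact S2V h c (i := i + 1) (by omega) (by omega) Set.right_mem_uIcc Set.left_mem_uIcc

lemma S2all (h : Poly n X Y) (c : Chord n k X Y) {q : ℝ × ℝ} (hq : q ∈ A2 k X Y)
    (hc : q ∉ CC k X Y) : p1 n k X Y q = p1 n k X Y (X 1, Y 1) := by
  have hk1 := c.k1
  have hk2 := c.k2
  have hne1 : Y k ≠ Y 0 := by rcases c.bY with h | h <;> intro e <;> linarith [h.1, h.2]
  have hq' := hq
  obtain ⟨a, b⟩ := q
  rw [mem_B2 h c] at hq'
  rcases hq' with h1 | ⟨i, i1, i2, e1, e2⟩ | ⟨i, hi, e1, e2⟩ | ⟨e1, e2⟩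
  · exact absurd h1 hc
  · obtain ⟨j, rfl⟩ : ∃ j, i = j + 1 := ⟨i - 1, by omega⟩
    simp only at e1 e2
    subst e1
    rw [S2H h c i1 i2 e2 Set.left_mem_uIcc, S2W h c j i2]
  · simp only at e1 e2
    subst e1
    rcases i with _ | i
    · have hb : b ≠ Y 0 := by
        rintro rfl
        exact hc ⟨rfl, Set.left_mem_uIcc⟩
      refine s2v h c fun y hy => ⟨?_, ?_⟩
      · rw [mem_B2 h c]
        right; right; left
        exact ⟨0, by omega, rfl, Set.uIcc_subset_uIcc e2 Set.right_mem_uIcc hy⟩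
      · rintro ⟨e, _⟩
        exact uIcc_not e2 hb hy e
    · rw [S2V h c (i := i + 1) (by omega) hi e2 Set.left_mem_uIcc,
        S2H h c (i := i + 1) (by omega) (by omega) Set.right_mem_uIcc Set.left_mem_uIcc,
        S2W h c i (by omega)]
  · simp only at e1 e2
    subst e1
    have hb : b ≠ Y 0 := by
      rintro rfl
      exact hc ⟨rfl, Set.right_mem_uIcc⟩
    have : p1 n k X Y (X (k + 1), b) = p1 n k X Y (X (k + 1), Y k) := by
      refine s2v h c fun y hy => ⟨?_, ?_⟩
      · rw [mem_B2 h c]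
        right; right; right
        exact ⟨rfl, Set.uIcc_subset_uIcc e2 Set.left_mem_uIcc hy⟩
      · rintro ⟨e, _⟩
        rw [Set.uIcc_comm] at e2
        exact uIcc_not e2 hb hy e
    obtain ⟨j, rfl⟩ : ∃ j, k = j + 1 := ⟨k - 1, by omega⟩
    rw [this, S2H h c (i := j + 1) (by omega) le_rfl Set.right_mem_uIcc Set.left_mem_uIcc,
      S2W h c j (by omega)]

lemma S1H (h : Poly n X Y) (c : Chord n k X Y) {i : ℕ} (i1 : k < i) (i2 : i < n) {s s' : ℝ}
    (hs : s ∈ Set.uIcc (X i) (X (i + 1))) (hs' : s' ∈ Set.uIcc (X i) (X (i + 1))) :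
    p2 k X Y (s, Y i) = p2 k X Y (s', Y i) := by
  have := c.k2
  refine s1h h c fun x hx => ⟨?_, ?_⟩
  · rw [mem_B1 h c]
    right; right; left; exact ⟨i, i1, i2, rfl, Set.uIcc_subset_uIcc hs hs' hx⟩
  · rintro ⟨e, _⟩
    have := h.iY i (by omega) 0 (by omega) e
    omega

lemma S1V (h : Poly n X Y) (c : Chord n k X Y) {i : ℕ} (i1 : k < i) (i2 : i < n) {s s' : ℝ}
    (hs : s ∈ Set.uIcc (Y i) (Y (i + 1))) (hs' : s' ∈ Set.uIcc (Y i) (Y (i + 1))) :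
    p2 k X Y (X (i + 1), s) = p2 k X Y (X (i + 1), s') := by
  have := c.k2
  refine s1v h c fun y hy => ⟨?_, ?_⟩
  · rw [mem_B1 h c]
    right; right; right; left; exact ⟨i, i1, i2, rfl, Set.uIcc_subset_uIcc hs hs' hy⟩
  · rintro ⟨e, e'⟩
    have h3 := Set.uIcc_subset_uIcc hs hs' hy
    simp only at e e'
    rw [e] at h3
    have := chord_v h c (j := i) (by omega) e' h3
    omega

lemma S1W (h : Poly n X Y) (c : Chord n k X Y) (i : ℕ) (i2 : k + 1 + i ≤ n) :
    p2 k X Y (X (k + 1 + i), Y (k + 1 + i)) = p2 k X Y (X (k + 1), Y (k + 1)) := by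
  induction i with
  | zero => rfl
  | succ i ih =>
    rw [← ih (by omega), S1H h c (i := k + 1 + i) (by omega) (by omega) (s := X (k + 1 + i))
      (s' := X (k + 1 + i + 1)) Set.left_mem_uIcc Set.right_mem_uIcc]
    exact S1V h c (i := k + 1 + i) (by omega) (by omega) Set.right_mem_uIcc Set.left_mem_uIcc

lemma S1all (h : Poly n X Y) (c : Chord n k X Y) {q : ℝ × ℝ} (hq : q ∈ A1 n k X Y)
    (hc : q ∉ CC k X Y) : p2 k X Y q = p2 k X Y (X (k + 1), Y (k + 1)) := by
  have hk1 := c.k1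
  have hk2 := c.k2
  have hq' := hq
  obtain ⟨a, b⟩ := q
  rw [mem_B1 h c] at hq'
  rcases hq' with h1 | ⟨e1, e2⟩ | ⟨i, i1, i2, e1, e2⟩ | ⟨i, i1, i2, e1, e2⟩ | ⟨e1, e2⟩
  · exact absurd h1 hc
  · simp only at e1 e2
    subst e1
    have hb : a ≠ X 1 := by
      rintro rfl
      exact hc ⟨rfl, Set.left_mem_uIcc⟩
    have h1 : p2 k X Y (a, Y 0) = p2 k X Y (X 0, Y 0) := by
      refine s1h h c fun x hx => ?_
      have hx2 : x ∈ Set.uIcc (X 0) (X 1) := Set.uIcc_subset_uIcc e2 Set.left_mem_uIcc hx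
      refine ⟨?_, ?_⟩
      · rw [mem_B1 h c]
        right; left
        exact ⟨rfl, hx2⟩
      · rintro ⟨_, e⟩
        have e3 := uIcc_inter c.bx hx2 e
        rw [Set.uIcc_comm] at e2
        exact uIcc_not e2 hb hx e3
    obtain ⟨j, rfl⟩ : ∃ j, n = k + 1 + j := ⟨n - (k + 1), by omega⟩
    rw [h1, ← h.cX, ← h.cY, S1W h c j le_rfl]
  · obtain ⟨j, rfl⟩ : ∃ j, i = k + 1 + j := ⟨i - (k + 1), by omega⟩
    simp only at e1 e2
    subst e1
    rw [S1H h c i1 i2 e2 Set.left_mem_uIcc, S1W h c j (by omega)]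
  · obtain ⟨j, rfl⟩ : ∃ j, i = k + 1 + j := ⟨i - (k + 1), by omega⟩
    simp only at e1 e2
    subst e1
    rw [S1V h c i1 i2 e2 Set.left_mem_uIcc,
        S1H h c i1 i2 Set.right_mem_uIcc Set.left_mem_uIcc, S1W h c j (by omega)]
  · simp only at e1 e2
    subst e1
    have hb : b ≠ Y 0 := by
      rintro rfl
      exact hc ⟨rfl, Set.right_mem_uIcc⟩
    refine s1v h c fun y hy => ⟨?_, ?_⟩
    · rw [mem_B1 h c]
      right; right; right; right
      exact ⟨rfl, Set.uIcc_subset_uIcc e2 Set.right_mem_uIcc hy⟩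
    · rintro ⟨e, _⟩
      exact uIcc_not e2 hb hy e

lemma nb {a b c e : ℝ} (h : Btw c a b) (he : 0 < e) : ∃ p m : ℝ, |p - a| < e ∧ |m - a| < e ∧
    Btw a p b ∧ Btw c m a ∧ Btw m a p := by
  unfold Btw at *
  set d := min (e / 2) (min (|b - a| / 2) (|c - a| / 2)) with hd
  have hb : 0 < |b - a| := abs_pos.2 (by intro h0; rcases h with h | h <;> linarith [h.1, h.2])
  have hc : 0 < |c - a| := abs_pos.2 (by intro h0; rcases h with h | h <;> linarith [h.1, h.2])
  have d0 : 0 < d := by rw [hd]; positivity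
  have d1 : d ≤ e / 2 := min_le_left _ _
  have d2 : d ≤ |b - a| / 2 := (min_le_right _ _).trans (min_le_left _ _)
  have d3 : d ≤ |c - a| / 2 := (min_le_right _ _).trans (min_le_right _ _)
  rcases h with ⟨h1, h2⟩ | ⟨h1, h2⟩
  · rw [abs_of_pos (by linarith : (0:ℝ) < b - a)] at d2
    rw [abs_of_neg (by linarith : c - a < 0)] at d3
    refine ⟨a + d, a - d, ?_, ?_, Or.inl ⟨?_, ?_⟩, Or.inl ⟨?_, ?_⟩, Or.inl ⟨?_, ?_⟩⟩ <;>
      first | linarith | (rw [abs_lt]; constructor <;> linarith)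
  · rw [abs_of_neg (by linarith : b - a < 0)] at d2
    rw [abs_of_pos (by linarith : 0 < c - a)] at d3
    refine ⟨a - d, a + d, ?_, ?_, Or.inr ⟨?_, ?_⟩, Or.inr ⟨?_, ?_⟩, Or.inr ⟨?_, ?_⟩⟩ <;>
      first | linarith | (rw [abs_lt]; constructor <;> linarith)

lemma near_r (h : Poly n X Y) (c : Chord n k X Y) : ∃ e > 0, ∀ p ∈ Box (X 1, Y 0) e,
    (p ∈ A1 n k X Y → p.2 = Y 0) ∧ (p ∈ A2 k X Y → p ∈ CC k X Y ∨ p ∈ VE X Y 0) := by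
  have hk1 := c.k1
  have hk2 := c.k2
  have P1 := poly1 h c
  have P2 := poly2 h c
  obtain ⟨e1, he1, H1⟩ := near (n := n - k) (X := Z1 k X) (Y := Z1 k Y) (X 1, Y 0)
  obtain ⟨e2, he2, H2⟩ := near (n := k + 1) (X := X2 k X) (Y := Y2 k Y) (X 1, Y 0)
  refine ⟨min e1 e2, lt_min he1 he2, fun p hp => ⟨fun h1 => ?_, fun h1 => ?_⟩⟩
  · obtain ⟨i, hi, ⟨h2, h3⟩ | ⟨h2, h3⟩⟩ := H1 p (box_mono (min_le_left _ _) hp) h1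
    · rw [h2.1, ← h3.1]
    · have := h3.1
      rw [Z1s] at this
      simp only at this
      have := h.iX' (i := 0) (j := i + k) (by omega) (by omega)
        (by rw [show i + k + 1 = i + 1 + k by omega, ← this])
      omega
  · obtain ⟨i, hi, ⟨h2, h3⟩ | ⟨h2, h3⟩⟩ := H2 p (box_mono (min_le_right _ _) hp) h1
    · have := h3.1
      simp only at this
      rw [Y2l (by omega)] at this
      have := h.iY 0 (by omega) i (by omega) this
      subst this
      left
      refine ⟨?_, ?_⟩
      · rw [h2.1, Y2l (by omega)]
      · have := h2.2
        rwa [X2z, X2s, Set.uIcc_comm] at this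
    · have := h3.1
      simp only at this
      rw [X2s] at this
      have := h.iX' (i := 0) (j := i) (by omega) (by omega) this
      subst this
      right
      refine ⟨?_, ?_⟩
      · rw [h2.1, X2s]
      · have := h2.2
        rwa [Y2l (by omega), Y2l (by omega)] at this

lemma alpha_beta (h : Poly n X Y) (c : Chord n k X Y) :
    p1 n k X Y (X 1, Y 1) = p2 k X Y (X (k + 1), Y (k + 1)) := by
  have hk1 := c.k1
  have hk2 := c.k2
  have P1 := poly1 h c
  have P2 := poly2 h c
  have hY01 : Y 0 ≠ Y 1 := h.neY (by omega)
  have hbY : Btw (2 * Y 0 - Y 1) (Y 0) (Y 1) := by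
    unfold Btw
    rcases lt_or_gt_of_ne hY01 with h1 | h1
    · left; constructor <;> linarith
    · right; constructor <;> linarith
  obtain ⟨e, he, H⟩ := near_r h c
  obtain ⟨x, x', hx1, hx1', hx2, hx3, hx4⟩ := nb c.bx he
  obtain ⟨y, y', hy1, hy1', hy2, hy3, hy4⟩ := nb hbY he
  have hx0 : |X 1 - X 1| < e := by simpa using he
  have hy0 : |Y 0 - Y 0| < e := by simpa using he
  have yne : y ≠ Y 0 := by rcases hy2 with h | h <;> intro e <;> linarith [h.1, h.2]
  have yne' : y' ≠ Y 0 := by rcases hy3 with h | h <;> intro e <;> linarith [h.1, h.2]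
  have xne : x ≠ X 1 := by rcases hx2 with h | h <;> intro e <;> linarith [h.1, h.2]
  have xne' : x' ≠ X 1 := by rcases hx3 with h | h <;> intro e <;> linarith [h.1, h.2]
  have xC : x' ∉ Set.uIcc (X 1) (X (k + 1)) := fun h0 =>
    xne' (uIcc_inter c.bx hx3.mem h0)
  have yC : y' ∉ Set.uIcc (Y 0) (Y 1) := fun h0 =>
    yne' (uIcc_inter hbY hy3.mem h0)
  -- first piece
  have E1 : p1 n k X Y (x, y) = p1 n k X Y (X 1, y) := by
    refine par_hmove P1 fun z hz hB => yne ?_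
    exact (H (z, y) ⟨abs_mid hx1 hx0 hz, hy1⟩).1 hB
  have E2 : p1 n k X Y (X 1, y) = p1 n k X Y (X 1, Y 1) := by
    refine S2all h c ?_ fun h0 => yne h0.1
    rw [mem_B2 h c]
    right; right; left
    exact ⟨0, by omega, rfl, hy2.mem⟩
  -- second piece
  have F1 : p2 k X Y (x', Y 0) = p2 k X Y (X (k + 1), Y (k + 1)) := by
    refine S1all h c ?_ fun h0 => xC h0.2
    rw [mem_B1 h c]
    right; left
    exact ⟨rfl, hx3.mem⟩
  have F2 : p2 k X Y (x', Y 0) = p2 k X Y (x', y') := by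
    refine par_vmove fun z hz hB => ?_
    rcases (H (x', z) ⟨hx1', abs_mid hy0 hy1' hz⟩).2 hB with h1 | h1
    · exact xC h1.2
    · exact xne' h1.1
  have F3 : p2 k X Y (x', y') = p2 k X Y (x, y') := by
    refine par_hmove P2 fun z hz hB => ?_
    rcases (H (z, y') ⟨abs_mid hx1' hx1 hz, hy1'⟩).2 hB with h1 | h1
    · exact yne' h1.1
    · exact yC h1.2
  have F4 : p2 k X Y (x, y') + p2 k X Y (x, y) = 1 := by
    refine par_vtog P2 (i := 0) (by omega) ?_ ?_ ?_
    · rw [X2z, X2s]; exact hx2.symm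
    · rw [Y2l (by omega)]; exact hy4
    · intro z hz hB
      rw [Y2l (by omega)]
      rcases (H (x, z) ⟨hx1, abs_mid hy1' hy1 hz⟩).2 hB with h1 | h1
      · exact h1.1
      · exact absurd h1.1 xne
  have G : par n X Y (x, y) = 1 := by
    rw [par_vmove (t' := Y 0), (c.free x hx2).2]
    intro z hz hB
    have hz0 : z = Y 0 := by
      have hb := H (x, z) ⟨hx1, abs_mid hy1 hy0 hz⟩
      rcases B_sub h c hB with h1 | h1
      · exact hb.1 h1
      · rcases hb.2 h1 with h2 | h2
        · exact h2.1
        · exact absurd h2.1 xne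
    subst hz0
    exact (c.free x hx2).1 hB
  have T := par_add h c (x, y)
  rw [G] at T
  change 1 = p1 n k X Y (x, y) + p2 k X Y (x, y) at T
  rw [E1, E2] at T
  rw [← F3, ← F2, F1] at F4
  have key : ∀ a b d : ZMod 2, 1 = a + d → b + d = 1 → a = b := by decide
  exact key _ _ _ T F4

lemma exists_max (n : ℕ) (hn : 0 < n) (Y : ℕ → ℝ) : ∃ i < n, ∀ j < n, Y j ≤ Y i := by
  obtain ⟨i, hi, H⟩ := Finset.exists_max_image (range n) Y ⟨0, by simpa using hn⟩
  exact ⟨i, by simpa using hi, fun j hj => H j (by simpa using hj)⟩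

lemma alpha_zero (h : Poly n X Y) (c : Chord n k X Y) :
    p1 n k X Y (X 1, Y 1) = 0 ∧ p2 k X Y (X (k + 1), Y (k + 1)) = 0 := by
  have hk1 := c.k1
  have hk2 := c.k2
  have hne : X 0 ≠ X 1 := by rcases c.bx with h | h <;> intro e <;> linarith [h.1, h.2]
  have hab := alpha_beta h c
  suffices p1 n k X Y (X 1, Y 1) = 0 ∨ p2 k X Y (X (k + 1), Y (k + 1)) = 0 by
    rcases this with h1 | h1
    · exact ⟨h1, by rw [← hab, h1]⟩
    · exact ⟨by rw [hab, h1], h1⟩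
  obtain ⟨i, hi, H⟩ := exists_max n (by omega) Y
  have T1 : ∀ x, p1 n k X Y (x, Y i) = 0 := by
    intro x
    apply par_top
    intro j hj
    rcases j with _ | j
    · rw [Z1z]; exact H 0 (by omega)
    · rw [Z1s]; exact H _ (by omega)
  have T2 : ∀ x, p2 k X Y (x, Y i) = 0 := by
    intro x
    apply par_top
    intro j hj
    rw [Y2l (by omega)]; exact H _ (by omega)
  rcases Nat.eq_zero_or_pos i with h0 | h0
  · subst h0
    right
    rw [← T2 (X 0)]
    symm
    refine S1all h c ?_ fun h1 => hne ?_
    · rw [mem_B1 h c]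
      right; left; exact ⟨rfl, Set.left_mem_uIcc⟩
    · exact uIcc_inter c.bx Set.left_mem_uIcc h1.2
  rcases Nat.lt_or_ge k i with h3 | h3
  · right
    rw [← T2 (X i)]
    symm
    refine S1all h c ?_ fun h1 => ?_
    · rw [mem_B1 h c]
      right; right; left; exact ⟨i, h3, hi, rfl, Set.left_mem_uIcc⟩
    · have := h.iY i hi 0 (by omega) h1.1
      omega
  · left
    rw [← T1 (X i)]
    symm
    refine S2all h c ?_ fun h1 => ?_
    · rw [mem_B2 h c]
      right; left; exact ⟨i, h0, h3, rfl, Set.left_mem_uIcc⟩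
    · have := h.iY i hi 0 (by omega) h1.1
      omega

lemma disj_aux (h : Poly n X Y) (c : Chord n k X Y) {q : ℝ × ℝ} (h1 : q ∉ A1 n k X Y)
    (h2 : q ∉ A2 k X Y) (hq : q.2 ≠ Y 0) : p1 n k X Y q = 0 ∨ p2 k X Y q = 0 := by
  have P1 := poly1 h c
  have P2 := poly2 h c
  obtain ⟨a0, b0⟩ := alpha_zero h c
  obtain ⟨s, t⟩ := q
  simp only at hq
  set T : Set ℝ := {x | s ≤ x ∧ (x, t) ∈ A1 n k X Y ∪ A2 k X Y} with hT
  have hTc : IsClosed T :=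
    isClosed_Ici.inter (((BB_closed (X := Z1 k X)).union BB_closed).preimage
      (Continuous.prodMk_left t))
  have nC : ∀ x, (x, t) ∉ CC k X Y := fun x h0 => hq h0.1
  rcases Set.eq_empty_or_nonempty T with hE | hN
  · left
    obtain ⟨M, _, hM⟩ := exists_bound (n - k) (Z1 k X)
    rw [p1, par_hmove P1 (s' := max s M)]
    · apply par_right P1
      intro i hi
      exact (le_abs_self _).trans ((hM i hi.le).le.trans (le_max_right _ _))
    · intro x hx hB
      rw [Set.uIcc_of_le (le_max_left _ _)] at hx
      have : x ∈ T := ⟨hx.1, Or.inl hB⟩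
      rw [hE] at this
      exact this
  · have hbd : BddBelow T := ⟨s, fun x hx => hx.1⟩
    have hx0 := hTc.csInf_mem hN hbd
    set x0 := sInf T
    have hlt : ∀ x ∈ Set.uIcc s x0, x ≠ x0 → (x, t) ∉ A1 n k X Y ∪ A2 k X Y := by
      intro x hx hne hB
      rw [Set.uIcc_of_le hx0.1] at hx
      exact hne (le_antisymm hx.2 (csInf_le hbd ⟨hx.1, hB⟩))
    rcases hx0.2 with h3 | h3
    · right
      rw [p2, par_hmove P2 (s' := x0), ← b0]
      · exact S1all h c h3 (nC _)
      · intro x hx hB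
        by_cases hne : x = x0
        · subst hne; exact nC _ (B12 h c h3 hB)
        · exact hlt x hx hne (Or.inr hB)
    · left
      rw [p1, par_hmove P1 (s' := x0), ← a0]
      · exact S2all h c h3 (nC _)
      · intro x hx hB
        by_cases hne : x = x0
        · subst hne; exact nC _ (B12 h c hB h3)
        · exact hlt x hx hne (Or.inl hB)

lemma disj (h : Poly n X Y) (c : Chord n k X Y) {q : ℝ × ℝ} (h1 : q ∉ A1 n k X Y)
    (h2 : q ∉ A2 k X Y) : p1 n k X Y q = 0 ∨ p2 k X Y q = 0 := by
  by_cases hq : q.2 = Y 0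
  · obtain ⟨e1, he1, H1⟩ := par_loc (poly1 h c) h1
    obtain ⟨e2, he2, H2⟩ := par_loc (poly2 h c) h2
    have h0 : 0 < min e1 e2 := lt_min he1 he2
    have hb : (q.1, q.2 + min e1 e2 / 2) ∈ Box q (min e1 e2) := by
      constructor
      · simpa using h0
      · simp only [add_sub_cancel_left]
        rw [abs_of_pos (by linarith)]; linarith
    have g1 := H1 _ (box_mono (min_le_left _ _) hb)
    have g2 := H2 _ (box_mono (min_le_right _ _) hb)
    have := disj_aux h c g1.1 g2.1 (by simp only; rw [hq]; intro h3; linarith)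
    rwa [p1, p2, g1.2, g2.2] at this
  · exact disj_aux h c h1 h2 hq

lemma CC_sub (h : Poly n X Y) (c : Chord n k X Y) : CC k X Y ⊆ RR n X Y := by
  have hk1 := c.k1
  have hk2 := c.k2
  rintro ⟨a, b⟩ ⟨e1, e2⟩
  simp only at e1 e2
  subst e1
  rcases uIcc_cases e2 with h1 | h1 | h1
  · left; exact ⟨0, by omega, Or.inl ⟨rfl, by rw [h1]; exact Set.right_mem_uIcc⟩⟩
  · left; exact ⟨k, by omega, Or.inr ⟨h1, c.bY.mem⟩⟩
  · right; exact (c.free a h1).2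

lemma RR_union (h : Poly n X Y) (c : Chord n k X Y) : RR n X Y =
    RR (n - k) (Z1 k X) (Z1 k Y) ∪ RR (k + 1) (X2 k X) (Y2 k Y) := by
  have hA1 : A1 n k X Y ⊆ RR n X Y := fun q hq => by
    rcases B1_sub h c hq with h1 | h1
    · exact Or.inl h1
    · exact CC_sub h c h1
  have hA2 : A2 k X Y ⊆ RR n X Y := fun q hq => by
    rcases B2_sub h c hq with h1 | h1
    · exact Or.inl h1
    · exact CC_sub h c h1
  ext q
  by_cases g1 : q ∈ A1 n k X Y
  · exact ⟨fun _ => Or.inl (Or.inl g1), fun _ => hA1 g1⟩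
  by_cases g2 : q ∈ A2 k X Y
  · exact ⟨fun _ => Or.inr (Or.inl g2), fun _ => hA2 g2⟩
  have hB : q ∉ BB n X Y := fun h0 => by
    rcases B_sub h c h0 with h1 | h1
    · exact g1 h1
    · exact g2 h1
  have hd := disj h c g1 g2
  have e0 : q ∈ RR n X Y ↔ par n X Y q = 1 := ⟨fun h0 => h0.resolve_left hB, Or.inr⟩
  have e1 : q ∈ RR (n - k) (Z1 k X) (Z1 k Y) ↔ p1 n k X Y q = 1 :=
    ⟨fun h0 => h0.resolve_left g1, Or.inr⟩
  have e2 : q ∈ RR (k + 1) (X2 k X) (Y2 k Y) ↔ p2 k X Y q = 1 :=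
    ⟨fun h0 => h0.resolve_left g2, Or.inr⟩
  rw [Set.mem_union, e0, e1, e2, par_add h c]
  rcases hd with h3 | h3
  · change p1 n k X Y q + p2 k X Y q = 1 ↔ _
    rw [h3]; simp
  · change p1 n k X Y q + p2 k X Y q = 1 ↔ _
    rw [h3]; simp

lemma RR_inter (h : Poly n X Y) (c : Chord n k X Y) :
    MeasureTheory.volume (RR (n - k) (Z1 k X) (Z1 k Y) ∩ RR (k + 1) (X2 k X) (Y2 k Y)) = 0 := by
  refine MeasureTheory.measure_mono_null (t := A1 n k X Y ∪ A2 k X Y) ?_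
    (MeasureTheory.measure_union_null BB_null BB_null)
  rintro q ⟨h1, h2⟩
  by_contra h3
  rw [Set.mem_union, not_or] at h3
  have g1 := h1.resolve_left h3.1
  have g2 := h2.resolve_left h3.2
  rcases disj h c h3.1 h3.2 with h4 | h4
  · rw [p1, g1] at h4; exact one_ne_zero h4
  · rw [p2, g2] at h4; exact one_ne_zero h4

lemma RR_vol (h : Poly n X Y) (c : Chord n k X Y) : MeasureTheory.volume (RR n X Y) =
    MeasureTheory.volume (RR (n - k) (Z1 k X) (Z1 k Y)) +
    MeasureTheory.volume (RR (k + 1) (X2 k X) (Y2 k Y)) := by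
  have := MeasureTheory.measure_union_add_inter (μ := MeasureTheory.volume)
    (RR (n - k) (Z1 k X) (Z1 k Y)) (RR_closed (poly2 h c)).measurableSet
  rw [RR_inter h c, add_zero, ← RR_union h c] at this
  exact this

end RP


namespace RP

open Finset

variable {n k : ℕ} {X Y X' Y' : ℕ → ℝ}

/-- initial vertices -/
noncomputable def V0 (n : ℕ) (X Y : ℕ → ℝ) : Finset (ℝ × ℝ) := (range n).image fun i => (X i, Y i)
/-- terminal vertices -/
noncomputable def V1 (n : ℕ) (X Y : ℕ → ℝ) : Finset (ℝ × ℝ) :=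
  (range n).image fun i => (X (i + 1), Y i)

/-- same polygon up to renumbering and orientation -/
structure Same (n : ℕ) (X Y X' Y' : ℕ → ℝ) : Prop where
  poly : Poly n X' Y'
  bb : BB n X' Y' = BB n X Y
  pp : ∀ p, par n X' Y' p = par n X Y p
  vv : (V0 n X' Y' = V0 n X Y ∧ V1 n X' Y' = V1 n X Y) ∨
    (V0 n X' Y' = V1 n X Y ∧ V1 n X' Y' = V0 n X Y)

lemma Same.trans {X'' Y'' : ℕ → ℝ} (a : Same n X Y X' Y') (b : Same n X' Y' X'' Y'') :
    Same n X Y X'' Y'' := by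
  refine ⟨b.poly, b.bb.trans a.bb, fun p => (b.pp p).trans (a.pp p), ?_⟩
  rcases a.vv with ⟨h1, h2⟩ | ⟨h1, h2⟩ <;> rcases b.vv with ⟨h3, h4⟩ | ⟨h3, h4⟩ <;>
    rw [h3, h4, h1, h2] <;> simp

lemma image_bij {n : ℕ} {s : ℕ → ℕ} (s1 : ∀ i < n, s i < n) (s3 : ∀ j < n, ∃ i < n, s i = j)
    (f g : ℕ → ℝ × ℝ) (hf : ∀ i < n, f i = g (s i)) : (range n).image f = (range n).image g := by
  ext q
  simp only [Finset.mem_image, Finset.mem_range]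
  constructor
  · rintro ⟨i, hi, rfl⟩
    exact ⟨s i, s1 i hi, (hf i hi).symm⟩
  · rintro ⟨j, hj, rfl⟩
    obtain ⟨i, hi, rfl⟩ := s3 j hj
    exact ⟨i, hi, hf i hi⟩

lemma same_of (h : Poly n X Y) (cX : X' n = X' 0) (cY : Y' n = Y' 0) (s r : ℕ → ℕ)
    (s1 : ∀ i < n, s i < n) (s2 : ∀ i < n, ∀ j < n, s i = s j → i = j)
    (s3 : ∀ j < n, ∃ i < n, s i = j)
    (r1 : ∀ i < n, r i < n)
    (r3 : ∀ j < n, ∃ i < n, r i = j)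
    (hY : ∀ i < n, Y' i = Y (s i))
    (hX : (∀ i < n, X' i = X (s i) ∧ X' (i + 1) = X (s i + 1)) ∨
      (∀ i < n, X' i = X (s i + 1) ∧ X' (i + 1) = X (s i)))
    (rX : ∀ i < n, X' (i + 1) = X (r i + 1))
    (rY : ∀ i < n, Set.uIcc (Y' i) (Y' (i + 1)) = Set.uIcc (Y (r i)) (Y (r i + 1))) :
    Same n X Y X' Y' := by
  have hU : ∀ i < n, Set.uIcc (X' i) (X' (i + 1)) = Set.uIcc (X (s i)) (X (s i + 1)) := by
    intro i hi
    rcases hX with hX | hX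
    · rw [(hX i hi).1, (hX i hi).2]
    · rw [(hX i hi).1, (hX i hi).2, Set.uIcc_comm]
  have hH : ∀ i < n, HE X' Y' i = HE X Y (s i) := by
    intro i hi
    ext q
    simp only [HE, Set.mem_ofPred_eq, hU i hi, hY i hi]
  have hV : ∀ i < n, VE X' Y' i = VE X Y (r i) := by
    intro i hi
    ext q
    simp only [VE, Set.mem_ofPred_eq, rX i hi, rY i hi]
  refine ⟨⟨h.hn, cX, cY, ?_, ?_, ?_⟩, ?_, ?_, ?_⟩
  · intro i hi j hj e
    rcases hX with hX | hX
    · rw [(hX i hi).1, (hX j hj).1] at e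
      exact s2 i hi j hj (h.iX _ (s1 i hi) _ (s1 j hj) e)
    · rw [(hX i hi).1, (hX j hj).1] at e
      exact s2 i hi j hj (h.iX' (s1 i hi) (s1 j hj) e)
  · intro i hi j hj e
    rw [hY i hi, hY j hj] at e
    exact s2 i hi j hj (h.iY _ (s1 i hi) _ (s1 j hj) e)
  · intro i hi j hj h1 h2
    rw [hU i hi, rX j hj] at h1
    rw [hY i hi, rY j hj] at h2
    have := h.cross _ (s1 i hi) _ (r1 j hj) h1 h2
    rw [rX j hj]
    rcases hX with hX | hX
    · rw [(hX i hi).1, (hX i hi).2]; exact this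
    · rw [(hX i hi).1, (hX i hi).2]; exact this.symm
  · ext q
    constructor
    · rintro ⟨i, hi, h1 | h1⟩
      · rw [hH i hi] at h1; exact ⟨s i, s1 i hi, Or.inl h1⟩
      · rw [hV i hi] at h1; exact ⟨r i, r1 i hi, Or.inr h1⟩
    · rintro ⟨j, hj, h1 | h1⟩
      · obtain ⟨i, hi, rfl⟩ := s3 j hj
        rw [← hH i hi] at h1; exact ⟨i, hi, Or.inl h1⟩
      · obtain ⟨i, hi, rfl⟩ := r3 j hj
        rw [← hV i hi] at h1; exact ⟨i, hi, Or.inr h1⟩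
  · intro p
    unfold par
    refine Finset.sum_bij (fun i _ => s i) ?_ ?_ ?_ ?_
    · intro i hi; simp only [Finset.mem_range] at *; exact s1 i hi
    · intro i hi j hj e; simp only [Finset.mem_range] at *; exact s2 i hi j hj e
    · intro j hj; simp only [Finset.mem_range] at *
      obtain ⟨i, hi, e⟩ := s3 j hj
      exact ⟨i, hi, e⟩
    · intro i hi
      simp only [Finset.mem_range] at hi
      rw [hY i hi]
      rcases hX with hX | hX
      · rw [(hX i hi).1, (hX i hi).2]
      · rw [(hX i hi).1, (hX i hi).2, add_comm (RP.hX _ _)]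
  · rcases hX with hX | hX
    · left
      constructor
      · exact image_bij s1 s3 _ _ fun i hi => by rw [(hX i hi).1, hY i hi]
      · exact image_bij s1 s3 _ _ fun i hi => by rw [(hX i hi).2, hY i hi]
    · right
      constructor
      · exact image_bij s1 s3 _ _ fun i hi => by rw [(hX i hi).1, hY i hi]
      · exact image_bij s1 s3 _ _ fun i hi => by rw [(hX i hi).2, hY i hi]

lemma mod_succ' {n : ℕ} (hn : 0 < n) (X : ℕ → ℝ) (c : X n = X 0) (j : ℕ) :
    X ((j + 1) % n) = X (j % n + 1) := by
  have h1 := Nat.mod_lt j hn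
  rw [Nat.add_mod]
  rcases Nat.lt_or_ge (j % n + 1) n with h2 | h2
  · rcases Nat.lt_or_ge 1 n with h3 | h3
    · rw [Nat.mod_eq_of_lt h3, Nat.mod_eq_of_lt h2]
    · omega
  · have h3 : j % n + 1 = n := by omega
    rcases Nat.lt_or_ge 1 n with h4 | h4
    · rw [Nat.mod_eq_of_lt h4, h3, Nat.mod_self, c]
    · have : n = 1 := by omega
      subst this
      simp [Nat.mod_one, c]

lemma rotate (h : Poly n X Y) {g : ℕ} (hg : g < n) :
    Same n X Y (fun i => X ((i + g) % n)) (fun i => Y ((i + g) % n)) := by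
  have hn := h.hn
  have hX : ∀ i, X ((i + 1 + g) % n) = X ((i + g) % n + 1) := fun i => by
    rw [show i + 1 + g = i + g + 1 by omega, mod_succ' (by omega) X h.cX]
  have hY : ∀ i, Y ((i + 1 + g) % n) = Y ((i + g) % n + 1) := fun i => by
    rw [show i + 1 + g = i + g + 1 by omega, mod_succ' (by omega) Y h.cY]
  have s3 : ∀ j < n, ∃ i < n, (i + g) % n = j := by
    intro j hj
    refine ⟨(j + (n - g)) % n, Nat.mod_lt _ (by omega), ?_⟩
    rw [Nat.mod_add_mod, show j + (n - g) + g = j + n by omega, Nat.add_mod_right,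
      Nat.mod_eq_of_lt hj]
  have s2 : ∀ i < n, ∀ j < n, (i + g) % n = (j + g) % n → i = j := by
    intro i hi j hj e
    have := Nat.ModEq.add_right_cancel' g (show i + g ≡ j + g [MOD n] from e)
    rwa [Nat.ModEq, Nat.mod_eq_of_lt hi, Nat.mod_eq_of_lt hj] at this
  refine same_of h ?_ ?_ (fun i => (i + g) % n) (fun i => (i + g) % n)
    (fun i _ => Nat.mod_lt _ (by omega)) s2 s3
    (fun i _ => Nat.mod_lt _ (by omega)) s3 (fun i _ => rfl) (Or.inl fun i _ => ⟨rfl, hX i⟩)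
    (fun i _ => hX i) (fun i _ => by simp only [hY i])
  · simp
  · simp

lemma reverse (h : Poly n X Y) :
    Same n X Y (fun i => if i = 0 then X 1 else X (n + 1 - i)) (fun i => Y (n - i)) := by
  have hn := h.hn
  refine same_of h ?_ ?_ (fun i => if i = 0 then 0 else n - i) (fun i => n - 1 - i) ?_ ?_ ?_ ?_ ?_
    ?_ ?_ ?_ ?_
  · rw [if_pos rfl, if_neg (by omega), show n + 1 - n = 1 by omega]
  · simp only [Nat.sub_self, Nat.sub_zero]; exact h.cY.symm
  · intro i hi; split_ifs <;> omega
  · intro i hi j hj; split_ifs <;> omega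
  · intro j hj
    rcases Nat.eq_zero_or_pos j with h0 | h0
    · exact ⟨0, by omega, by rw [h0]; simp⟩
    · exact ⟨n - j, by omega, by rw [if_neg (by omega)]; omega⟩
  · intro i hi; omega
  · intro j hj; exact ⟨n - 1 - j, by omega, by omega⟩
  · intro i hi
    split_ifs with h0
    · rw [h0, Nat.sub_zero, h.cY]
    · rfl
  · right
    intro i hi
    rw [if_neg (show ¬ (i + 1 = 0) by omega), show n + 1 - (i + 1) = n - i by omega]
    rcases Nat.eq_zero_or_pos i with h0 | h0
    · subst h0
      simp only [if_true, Nat.sub_zero]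
      exact ⟨trivial, h.cX⟩
    · rw [if_neg (show ¬ (i = 0) by omega), if_neg (show ¬ (i = 0) by omega),
        show n + 1 - i = n - i + 1 by omega]
      exact ⟨rfl, rfl⟩
  · intro i hi
    rw [if_neg (by omega), show n + 1 - (i + 1) = n - 1 - i + 1 by omega]
  · intro i hi
    rw [show n - 1 - i + 1 = n - i by omega, show n - (i + 1) = n - 1 - i by omega, Set.uIcc_comm]

/-- a raw chord normalizes to a chord along edge zero -/
lemma chord_norm (h : Poly n X Y) {xs : ℝ} (hp : (xs, Y 0) ∈ BB n X Y)
    (hb : Btw (X 0) (X 1) xs)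
    (free : ∀ x, Btw (X 1) x xs → (x, Y 0) ∉ BB n X Y ∧ par n X Y (x, Y 0) = 1) :
    ∃ k, Chord n k X Y := by
  have hn := h.hn
  have hne1 : xs ≠ X 1 := by rcases hb with h | h <;> intro e <;> linarith [h.1, h.2]
  have hne0 : xs ≠ X 0 := by rcases hb with h | h <;> intro e <;> linarith [h.1, h.2]
  obtain ⟨k, hk, ⟨e1, e2⟩ | ⟨e1, e2⟩⟩ := hp
  · have := h.iY 0 (by omega) k hk e1
    subst this
    exact absurd (uIcc_inter hb e2 Set.right_mem_uIcc) hne1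
  · simp only at e1 e2
    have k0 : k ≠ 0 := by rintro rfl; exact hne1 e1
    have kn : k + 1 ≠ n := by
      intro e
      rw [e, h.cX] at e1
      exact hne0 e1
    refine ⟨k, by omega, by omega, by rwa [← e1], ?_, by rwa [← e1]⟩
    rcases uIcc_cases e2 with h1 | h1 | h1
    · have := h.iY 0 (by omega) k hk h1; omega
    · have := h.iY 0 (by omega) (k + 1) (by omega) h1; omega
    · exact h1

lemma chord_of_raw (h : Poly n X Y) {g : ℕ} (hg : g < n) {xs : ℝ} (hp : (xs, Y g) ∈ BB n X Y)
    (H : (Btw (X g) (X (g + 1)) xs ∧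
        ∀ x, Btw (X (g + 1)) x xs → (x, Y g) ∉ BB n X Y ∧ par n X Y (x, Y g) = 1) ∨
      (Btw (X (g + 1)) (X g) xs ∧
        ∀ x, Btw (X g) x xs → (x, Y g) ∉ BB n X Y ∧ par n X Y (x, Y g) = 1)) :
    ∃ X' Y' k, Same n X Y X' Y' ∧ Chord n k X' Y' := by
  have hn := h.hn
  have hr := rotate h hg
  have e0 : X ((0 + g) % n) = X g := by rw [Nat.zero_add, Nat.mod_eq_of_lt hg]
  have e1 : X ((1 + g) % n) = X (g + 1) := by
    rw [Nat.add_comm, mod_succ' (by omega) X h.cX, Nat.mod_eq_of_lt hg]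
  have e2 : Y ((0 + g) % n) = Y g := by rw [Nat.zero_add, Nat.mod_eq_of_lt hg]
  rcases H with ⟨hb, free⟩ | ⟨hb, free⟩
  · obtain ⟨k, c⟩ := chord_norm hr.poly (xs := xs) (by rw [hr.bb, e2]; exact hp)
      (by rw [e0, e1]; exact hb) (by rw [hr.bb, e1, e2]; simp only [hr.pp]; exact free)
    exact ⟨_, _, k, hr, c⟩
  · have hs := hr.trans (reverse hr.poly)
    have e3 : Y ((n - 0 + g) % n) = Y g := by
      rw [Nat.sub_zero, Nat.add_mod_left, Nat.mod_eq_of_lt hg]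
    have e4 : X ((n + 1 - 1 + g) % n) = X g := by
      rw [Nat.add_sub_cancel, Nat.add_mod_left, Nat.mod_eq_of_lt hg]
    obtain ⟨k, c⟩ := chord_norm hs.poly (xs := xs) (by rw [hs.bb]; simp only [e3]; exact hp)
      (by simp only [one_ne_zero, if_true, if_false]; rw [e4, e1]; exact hb)
      (by rw [hs.bb]; simp only [hs.pp, one_ne_zero, if_false]; rw [e4, e3]; exact free)
    exact ⟨_, _, k, hs, c⟩

end RP


namespace RP

open Finset

variable {n k : ℕ} {X Y X' Y' : ℕ → ℝ}

lemma order_aux {a b c d xs x0 : ℝ} (hcd : c ≠ d) (hs : xs = a ∨ xs = b)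
    (hx : xs ∉ Set.uIcc c d) (h1 : x0 ∈ Set.uIcc c d) (h2 : x0 ∈ Set.uIcc a b) :
    (Btw c d xs ∧ ∀ x, Btw d x xs → Btw a x b ∧ x ∉ Set.uIcc c d) ∨
    (Btw d c xs ∧ ∀ x, Btw c x xs → Btw a x b ∧ x ∉ Set.uIcc c d) := by
  simp only [Set.mem_uIcc, Btw] at *
  rcases lt_or_gt_of_ne hcd with h3 | h3
  · rcases lt_or_ge d xs with h4 | h4
    · left; refine ⟨Or.inl ⟨h3, h4⟩, fun x hx => ?_⟩
      grind
    · right; refine ⟨Or.inr ⟨by grind, h3⟩, fun x hx => ?_⟩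
      grind
  · rcases lt_or_ge c xs with h4 | h4
    · right; refine ⟨Or.inl ⟨h3, h4⟩, fun x hx => ?_⟩
      grind
    · left; refine ⟨Or.inr ⟨by grind, h3⟩, fun x hx => ?_⟩
      grind

lemma exists_cand (h : Poly n X Y) (hn : 3 ≤ n) : ∃ g < n, g ≠ 1 ∧
    (∃ x, x ∈ Set.uIcc (X g) (X (g + 1)) ∧ x ∈ Set.uIcc (X 1) (X 2)) ∧
    ∀ j < n, j ≠ 1 → ∀ x, x ∈ Set.uIcc (X j) (X (j + 1)) → x ∈ Set.uIcc (X 1) (X 2) →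
      Y j ≤ Y g := by
  classical
  obtain ⟨g, hg, H⟩ := Finset.exists_max_image ((range n).filter fun j => j ≠ 1 ∧
    ∃ x, x ∈ Set.uIcc (X j) (X (j + 1)) ∧ x ∈ Set.uIcc (X 1) (X 2)) Y
    ⟨0, by
      rw [Finset.mem_filter, Finset.mem_range]
      exact ⟨by omega, by omega, X 1, Set.right_mem_uIcc, Set.left_mem_uIcc⟩⟩
  rw [Finset.mem_filter, Finset.mem_range] at hg
  refine ⟨g, hg.1, hg.2.1, hg.2.2, fun j hj hj1 x h1 h2 => H j ?_⟩
  rw [Finset.mem_filter, Finset.mem_range]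
  exact ⟨hj, hj1, x, h1, h2⟩

lemma raw (h : Poly n X Y) (hn : 3 ≤ n) (hm : ∀ j < n, Y j ≤ Y 1) :
    ∃ X' Y' k, Same n X Y X' Y' ∧ Chord n k X' Y' := by
  obtain ⟨g, hg, hg1, ⟨x0, hx0, hx0'⟩, H⟩ := exists_cand h hn
  have y0 : Y 0 ≤ Y g := H 0 (by omega) (by omega) (X 1) Set.right_mem_uIcc Set.left_mem_uIcc
  have y2 : Y 2 ≤ Y g := H 2 (by omega) (by omega) (X 2) Set.left_mem_uIcc Set.right_mem_uIcc
  have y1 : Y g < Y 1 := lt_of_le_of_ne (hm g hg) fun e => hg1 (h.iY g hg 1 (by omega) e)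
  -- the strip between the two edges is free
  have F : ∀ x, Btw (X 1) x (X 2) → x ∉ Set.uIcc (X g) (X (g + 1)) → ∀ y, Y g ≤ y → y < Y 1 →
      (x, y) ∉ BB n X Y := by
    rintro x hx hxg y hy1 hy2 ⟨j, hj, ⟨e1, e2⟩ | ⟨e1, e2⟩⟩
    · simp only at e1 e2
      have hj1 : j ≠ 1 := by rintro rfl; linarith
      have := H j hj hj1 x e2 hx.mem
      have e3 := h.iY j hj g hg (by linarith)
      subst e3
      exact hxg e2
    · simp only at e1 e2
      have ne1 : x ≠ X 1 := by rcases hx with h | h <;> intro e <;> linarith [h.1, h.2]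
      have ne2 : x ≠ X 2 := by rcases hx with h | h <;> intro e <;> linarith [h.1, h.2]
      have hj1 : j ≠ 1 := by rintro rfl; exact ne2 e1
      have hj0 : j ≠ 0 := by rintro rfl; exact ne1 e1
      have g1 := H j hj hj1 x (by rw [e1]; exact Set.right_mem_uIcc) hx.mem
      obtain ⟨j', hj', e4, e5, e6⟩ : ∃ j' < n, X (j + 1) = X j' ∧ Y (j + 1) = Y j' ∧ j' ≠ 1 := by
        rcases Nat.lt_or_ge (j + 1) n with h1 | h1
        · exact ⟨j + 1, h1, rfl, rfl, by omega⟩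
        · have e : j + 1 = n := by omega
          exact ⟨0, by omega, by rw [e, h.cX], by rw [e, h.cY], by omega⟩
      have g2 := H j' hj' e6 x (by rw [e1, e4]; exact Set.left_mem_uIcc) hx.mem
      rw [e5, Set.mem_uIcc] at e2
      have : Y j = Y g ∨ Y j' = Y g := by
        rcases e2 with e2 | e2
        · right; linarith [e2.1, e2.2]
        · left; linarith [e2.1, e2.2]
      rcases this with e7 | e7
      · have := h.iY j hj g hg e7
        subst this
        exact hxg (by rw [e1]; exact Set.right_mem_uIcc)
      · have := h.iY j' hj' g hg e7
        subst this
        exact hxg (by rw [e1, e4]; exact Set.left_mem_uIcc)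
  have F2 : ∀ x, Btw (X 1) x (X 2) ∧ x ∉ Set.uIcc (X g) (X (g + 1)) →
      (x, Y g) ∉ BB n X Y ∧ par n X Y (x, Y g) = 1 := by
    rintro x ⟨hx, hxg⟩
    refine ⟨F x hx hxg _ le_rfl y1, ?_⟩
    have h0 : par n X Y (x, Y 1 + 1) = 0 := par_top fun i hi => by
      have := hm i hi
      simp only; linarith
    have ht := par_vtog h (i := 1) (by omega) hx (t := Y g) (t' := Y 1 + 1)
      (Or.inl ⟨y1, by linarith⟩) ?_
    · rwa [h0, add_zero] at ht
    · intro y hy hB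
      rw [Set.uIcc_of_le (by linarith)] at hy
      rcases lt_trichotomy y (Y 1) with h1 | h1 | h1
      · exact absurd hB (F x hx hxg y hy.1 h1)
      · exact h1
      · exfalso
        obtain ⟨j, hj, ⟨e1, e2⟩ | ⟨e1, e2⟩⟩ := hB
        · have := hm j hj
          simp only at e1
          linarith
        · obtain ⟨j', hj', e⟩ := h.exY hj
          have a1 := hm j hj
          have a2 := hm j' hj'
          simp only [e, Set.mem_uIcc] at e2
          rcases e2 with e2 | e2 <;> linarith [e2.1, e2.2]
  have key : ∃ xs, (xs = X 1 ∨ xs = X 2) ∧ xs ∉ Set.uIcc (X g) (X (g + 1)) ∧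
      (xs, Y g) ∈ BB n X Y := by
    by_cases c1 : X 1 ∈ Set.uIcc (X g) (X (g + 1))
    · have g0 : g = 0 := by
        rcases h.cross g hg 0 (by omega) c1 (by rw [Set.mem_uIcc]; left; exact ⟨y0, y1.le⟩)
          with e | e
        · exact absurd (h.iX g hg 1 (by omega) e.symm) hg1
        · exact (h.iX' (i := 0) (by omega) hg e).symm
      refine ⟨X 2, Or.inr rfl, fun c2 => ?_, 1, by omega, Or.inr ⟨rfl, ?_⟩⟩
      · rcases h.cross g hg 1 (by omega) c2 (by rw [Set.mem_uIcc]; right; exact ⟨y2, y1.le⟩)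
          with e | e
        · have := h.iX g hg 2 (by omega) e.symm
          omega
        · have := h.iX' (i := 1) (by omega) hg e
          omega
      · rw [Set.mem_uIcc]; right; exact ⟨y2, y1.le⟩
    · refine ⟨X 1, Or.inl rfl, c1, 0, by omega, Or.inr ⟨rfl, ?_⟩⟩
      rw [Set.mem_uIcc]; left; exact ⟨y0, y1.le⟩
  obtain ⟨xs, hs, hxs, hp⟩ := key
  refine chord_of_raw h hg hp ?_
  rcases order_aux (h.neX hg) hs hxs hx0 hx0' with ⟨h1, h2⟩ | ⟨h1, h2⟩
  · left; exact ⟨h1, fun x hx => F2 x (h2 x hx)⟩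
  · right; exact ⟨h1, fun x hx => F2 x (h2 x hx)⟩

theorem exists_chord (h : Poly n X Y) (hn : 3 ≤ n) :
    ∃ X' Y' k, Same n X Y X' Y' ∧ Chord n k X' Y' := by
  obtain ⟨m, hm, H⟩ := exists_max n (by omega) Y
  have hr := rotate h (g := (m + (n - 1)) % n) (Nat.mod_lt _ (by omega))
  obtain ⟨X', Y', k, s, c⟩ := raw hr.poly hn (by
    intro j hj
    have e : (1 + (m + (n - 1)) % n) % n = m := by
      rw [Nat.add_mod_mod, show 1 + (m + (n - 1)) = m + n by omega, Nat.add_mod_right,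
        Nat.mod_eq_of_lt hm]
    simp only [e]
    exact H _ (Nat.mod_lt _ (by omega)))
  exact ⟨X', Y', k, hr.trans s, c⟩

end RP


namespace RP

open Finset

variable {n k : ℕ} {X Y X' Y' : ℕ → ℝ}

/-- a rectangle transformation -/
noncomputable def step (V : Finset (ℝ × ℝ)) (a b : ℝ × ℝ) : Finset (ℝ × ℝ) :=
  (V \ {a, b}) ∪ {(b.1, a.2), (a.1, b.2)}

/-- the list of moves transforms one finite set into another -/
def Tr : Finset (ℝ × ℝ) → List ((ℝ × ℝ) × (ℝ × ℝ)) → Finset (ℝ × ℝ) → Prop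
  | V, [], W => V = W
  | V, p :: L, W => p.1 ∈ V ∧ p.2 ∈ V ∧ p.1 ≠ p.2 ∧ Tr (step V p.1 p.2) L W

lemma Tr.append {V W U : Finset (ℝ × ℝ)} {L L' : List ((ℝ × ℝ) × (ℝ × ℝ))} (h : Tr V L W)
    (h' : Tr W L' U) : Tr V (L ++ L') U := by
  induction L generalizing V with
  | nil => have e : V = W := h
           subst e; exact h'
  | cons p L ih =>
    obtain ⟨h1, h2, h3, h4⟩ := h
    exact ⟨h1, h2, h3, ih h4⟩

lemma Tr.frame {G : ℝ × ℝ → Prop} (hG : ∀ a b, G a → G b → G (b.1, a.2)) {Z : Finset (ℝ × ℝ)}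
    (hZ : ∀ z ∈ Z, ¬ G z) {V W : Finset (ℝ × ℝ)} {L : List ((ℝ × ℝ) × (ℝ × ℝ))}
    (hV : ∀ v ∈ V, G v) (h : Tr V L W) : Tr (V ∪ Z) L (W ∪ Z) := by
  induction L generalizing V with
  | nil => have e : V = W := h
           subst e; exact rfl
  | cons p L ih =>
    obtain ⟨h1, h2, h3, h4⟩ := h
    refine ⟨Finset.mem_union_left _ h1, Finset.mem_union_left _ h2, h3, ?_⟩
    have g1 := hV _ h1
    have g2 := hV _ h2
    have e : step (V ∪ Z) p.1 p.2 = step V p.1 p.2 ∪ Z := by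
      ext z
      simp only [step, Finset.mem_union, Finset.mem_sdiff, Finset.mem_insert, Finset.mem_singleton]
      by_cases hz : z ∈ Z
      · have a1 : z ≠ p.1 := fun e => hZ z hz (e ▸ g1)
        have a2 : z ≠ p.2 := fun e => hZ z hz (e ▸ g2)
        tauto
      · tauto
    rw [e]
    refine ih ?_ h4
    intro v hv
    simp only [step, Finset.mem_union, Finset.mem_sdiff, Finset.mem_insert,
      Finset.mem_singleton] at hv
    rcases hv with h5 | h5 | h5
    · exact hV v h5.1
    · rw [h5]; exact hG _ _ g1 g2
    · rw [h5]; exact hG _ _ g2 g1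

open MeasureTheory in
/-- a good sequence of transformations tiling `R` -/
def C (V W : Finset (ℝ × ℝ)) (R : Set (ℝ × ℝ)) : Prop :=
  ∃ L : List ((ℝ × ℝ) × (ℝ × ℝ)), Tr V L W ∧ (∀ p ∈ L, rect p.1 p.2 ⊆ R) ∧
    L.Pairwise (fun p q => interior (rect p.1 p.2) ∩ interior (rect q.1 q.2) = ∅) ∧
    (L.map fun p => volume (rect p.1 p.2)).sum = volume R

lemma C.frame {G : ℝ × ℝ → Prop} (hG : ∀ a b, G a → G b → G (b.1, a.2)) {Z : Finset (ℝ × ℝ)}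
    (hZ : ∀ z ∈ Z, ¬ G z) {V W : Finset (ℝ × ℝ)} {R : Set (ℝ × ℝ)}
    (hV : ∀ v ∈ V, G v) (h : C V W R) : C (V ∪ Z) (W ∪ Z) R := by
  obtain ⟨L, h1, h2⟩ := h
  exact ⟨L, h1.frame hG hZ hV, h2⟩

open MeasureTheory in
lemma C.concat {V W U : Finset (ℝ × ℝ)} {R R1 R2 : Set (ℝ × ℝ)} (h1 : C V W R1) (h2 : C W U R2)
    (hR : R1 ∪ R2 ⊆ R) (hn : volume (R1 ∩ R2) = 0)
    (hv : volume R = volume R1 + volume R2) : C V U R := by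
  obtain ⟨L, a1, a2, a3, a4⟩ := h1
  obtain ⟨L', b1, b2, b3, b4⟩ := h2
  refine ⟨L ++ L', a1.append b1, ?_, ?_, ?_⟩
  · intro p hp
    rcases List.mem_append.1 hp with h | h
    · exact (a2 p h).trans (Set.subset_union_left.trans hR)
    · exact (b2 p h).trans (Set.subset_union_right.trans hR)
  · rw [List.pairwise_append]
    refine ⟨a3, b3, fun p hp q hq => ?_⟩
    rw [← (isOpen_interior.inter isOpen_interior).measure_eq_zero_iff (μ := volume)]
    refine measure_mono_null ?_ hn
    exact Set.inter_subset_inter (interior_subset.trans (a2 p hp)) (interior_subset.trans (b2 q hq))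
  · rw [List.map_append, List.sum_append, a4, b4, hv]

lemma mem_rect {a b q : ℝ × ℝ} :
    q ∈ rect a b ↔ q.1 ∈ Set.uIcc a.1 b.1 ∧ q.2 ∈ Set.uIcc a.2 b.2 := Iff.rfl

lemma RR_two (h : Poly 2 X Y) : RR 2 X Y = rect (X 0, Y 0) (X 1, Y 1) := by
  have cX := h.cX
  have cY := h.cY
  have hp : ∀ q, par 2 X Y q = (hX (X 0) q.1 + hX (X 1) q.1) * (gY (Y 0) q.2 + gY (Y 1) q.2) := by
    intro q
    unfold par
    rw [Finset.sum_range_succ, Finset.sum_range_one, cX]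
    ring
  ext q
  rw [mem_rect]
  simp only
  constructor
  · rintro (⟨i, hi, ⟨h1, h2⟩ | ⟨h1, h2⟩⟩ | h1)
    · interval_cases i
      · exact ⟨h2, by rw [h1]; exact Set.left_mem_uIcc⟩
      · rw [cX, Set.uIcc_comm] at h2
        exact ⟨h2, by rw [h1]; exact Set.right_mem_uIcc⟩
    · interval_cases i
      · exact ⟨by rw [h1]; exact Set.right_mem_uIcc, h2⟩
      · rw [cY, Set.uIcc_comm] at h2
        rw [cX] at h1
        exact ⟨by rw [h1]; exact Set.left_mem_uIcc, h2⟩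
    · rw [hp] at h1
      constructor
      · apply hX_ne; intro h0; rw [h0, zero_mul] at h1; exact zero_ne_one h1
      · apply gY_ne; intro h0; rw [h0, mul_zero] at h1; exact zero_ne_one h1
  · rintro ⟨h1, h2⟩
    rcases uIcc_cases h1 with e1 | e1 | e1
    · left; refine ⟨1, by omega, Or.inr ⟨by rw [cX]; exact e1, ?_⟩⟩
      rw [cY, Set.uIcc_comm]; exact h2
    · left; exact ⟨0, by omega, Or.inr ⟨e1, h2⟩⟩
    · rcases uIcc_cases h2 with e2 | e2 | e2
      · left; exact ⟨0, by omega, Or.inl ⟨e2, h1⟩⟩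
      · left; refine ⟨1, by omega, Or.inl ⟨e2, ?_⟩⟩
        rw [cX, Set.uIcc_comm]; exact h1
      · right
        rw [hp, hX_btw e1, gY_btw e2]; rfl

lemma C.single {a b : ℝ × ℝ} {R : Set (ℝ × ℝ)} (hab : a ≠ b) (hR : R = rect a b) :
    C {a, b} {(b.1, a.2), (a.1, b.2)} R := by
  refine ⟨[(a, b)], ⟨by simp, by simp, hab, ?_⟩, ?_, ?_, ?_⟩
  · change step _ _ _ = _
    simp [step]
  · intro p hp
    rw [List.mem_singleton] at hp
    rw [hp, hR]
  · simp
  · simp [hR]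

lemma mem_V0 {q : ℝ × ℝ} : q ∈ V0 n X Y ↔ ∃ i < n, (X i, Y i) = q := by simp [V0]
lemma mem_V1 {q : ℝ × ℝ} : q ∈ V1 n X Y ↔ ∃ i < n, (X (i + 1), Y i) = q := by simp [V1]

lemma base (h : Poly 2 X Y) :
    C (V0 2 X Y) (V1 2 X Y) (RR 2 X Y) ∧ C (V1 2 X Y) (V0 2 X Y) (RR 2 X Y) := by
  have cX := h.cX
  have ne : X 0 ≠ X 1 := h.neX (by omega)
  have e0 : V0 2 X Y = {(X 0, Y 0), (X 1, Y 1)} := by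
    simp [V0, Finset.range_add_one, Finset.pair_comm]
  have e1 : V1 2 X Y = {(X 1, Y 0), (X 0, Y 1)} := by
    simp [V1, Finset.range_add_one, Finset.pair_comm, cX]
  rw [e0, e1]
  constructor
  · exact C.single (a := (X 0, Y 0)) (b := (X 1, Y 1)) (by intro e; exact ne (Prod.ext_iff.1 e).1)
      (RR_two h)
  · refine C.single (a := (X 1, Y 0)) (b := (X 0, Y 1))
      (by intro e; exact ne (Prod.ext_iff.1 e).1.symm) ?_
    rw [RR_two h]
    ext q
    rw [mem_rect, mem_rect]
    simp only
    rw [Set.uIcc_comm]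

/-- untouched initial vertices -/
noncomputable def ZZ (k : ℕ) (X Y : ℕ → ℝ) : Finset (ℝ × ℝ) :=
  (range k).image fun i => (X (i + 1), Y (i + 1))
/-- untouched terminal vertices -/
noncomputable def UU (n k : ℕ) (X Y : ℕ → ℝ) : Finset (ℝ × ℝ) :=
  (range (n - (k + 1))).image fun i => (X (i + 1 + k + 1), Y (i + 1 + k))

lemma mem_ZZ {q : ℝ × ℝ} : q ∈ ZZ k X Y ↔ ∃ i < k, (X (i + 1), Y (i + 1)) = q := by simp [ZZ]
lemma mem_UU {q : ℝ × ℝ} :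
    q ∈ UU n k X Y ↔ ∃ i < n - (k + 1), (X (i + 1 + k + 1), Y (i + 1 + k)) = q := by simp [UU]

lemma split0 (c : Chord n k X Y) : V0 n X Y = V0 (n - k) (Z1 k X) (Z1 k Y) ∪ ZZ k X Y := by
  have hk1 := c.k1
  have hk2 := c.k2
  ext q
  rw [Finset.mem_union, mem_V0, mem_V0, mem_ZZ]
  constructor
  · rintro ⟨i, hi, rfl⟩
    rcases Nat.eq_zero_or_pos i with h0 | h0
    · left; exact ⟨0, by omega, by rw [Z1z, Z1z, h0]⟩
    rcases Nat.lt_or_ge k i with h1 | h1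
    · left; refine ⟨i - k - 1 + 1, by omega, ?_⟩
      rw [Z1s, Z1s, show i - k - 1 + 1 + k = i by omega]
    · right; exact ⟨i - 1, by omega, by rw [show i - 1 + 1 = i by omega]⟩
  · rintro (⟨i, hi, rfl⟩ | ⟨i, hi, rfl⟩)
    · rcases i with _ | i
      · exact ⟨0, by omega, by rw [Z1z, Z1z]⟩
      · exact ⟨i + 1 + k, by omega, by rw [Z1s, Z1s]⟩
    · exact ⟨i + 1, by omega, rfl⟩

lemma split_mid (c : Chord n k X Y) : V1 (n - k) (Z1 k X) (Z1 k Y) ∪ ZZ k X Y =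
    V0 (k + 1) (X2 k X) (Y2 k Y) ∪ UU n k X Y := by
  have hk1 := c.k1
  have hk2 := c.k2
  ext q
  rw [Finset.mem_union, Finset.mem_union, mem_V1, mem_V0, mem_ZZ, mem_UU]
  constructor
  · rintro (⟨i, hi, rfl⟩ | ⟨i, hi, rfl⟩)
    · rcases i with _ | i
      · left; refine ⟨0, by omega, ?_⟩
        rw [Z1z, Z1s, X2z, Y2l (by omega), show 0 + 1 + k = k + 1 by omega]
      · right; refine ⟨i, by omega, ?_⟩
        rw [Z1s, Z1s, show i + 1 + 1 + k = i + 1 + k + 1 by omega]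
    · left; refine ⟨i + 1, by omega, ?_⟩
      rw [X2s, Y2l (by omega)]
  · rintro (⟨i, hi, rfl⟩ | ⟨i, hi, rfl⟩)
    · rcases i with _ | i
      · left; refine ⟨0, by omega, ?_⟩
        rw [Z1z, Z1s, X2z, Y2l (by omega), show 0 + 1 + k = k + 1 by omega]
      · right; refine ⟨i, by omega, ?_⟩
        rw [X2s, Y2l (by omega)]
    · left; refine ⟨i + 1, by omega, ?_⟩
      rw [Z1s, Z1s, show i + 1 + 1 + k = i + 1 + k + 1 by omega]

lemma split1 (c : Chord n k X Y) : V1 n X Y = V1 (k + 1) (X2 k X) (Y2 k Y) ∪ UU n k X Y := by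
  have hk1 := c.k1
  have hk2 := c.k2
  ext q
  rw [Finset.mem_union, mem_V1, mem_V1, mem_UU]
  constructor
  · rintro ⟨i, hi, rfl⟩
    rcases Nat.lt_or_ge k i with h1 | h1
    · right; refine ⟨i - k - 1, by omega, ?_⟩
      rw [show i - k - 1 + 1 + k = i by omega]
    · left; exact ⟨i, by omega, by rw [X2s, Y2l (by omega)]⟩
  · rintro (⟨i, hi, rfl⟩ | ⟨i, hi, rfl⟩)
    · exact ⟨i, by omega, by rw [X2s, Y2l (by omega)]⟩
    · exact ⟨i + 1 + k, by omega, rfl⟩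

lemma frame1 (h : Poly n X Y) (c : Chord n k X Y) {V W : Finset (ℝ × ℝ)} {R : Set (ℝ × ℝ)}
    (hV : ∀ v ∈ V, ∃ i < n - k, v.1 = Z1 k X i)
    (H : C V W R) : C (V ∪ ZZ k X Y) (W ∪ ZZ k X Y) R := by
  have hk1 := c.k1
  have hk2 := c.k2
  refine H.frame (G := fun q => ∀ i < k, q.1 ≠ X (i + 1)) (fun a b _ hb => hb) ?_ ?_
  · intro z hz hG
    obtain ⟨i, hi, rfl⟩ := mem_ZZ.1 hz
    exact hG i hi rfl
  · intro v hv i hi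
    obtain ⟨j, hj, e⟩ := hV v hv
    rw [e]
    rcases j with _ | j
    · rw [Z1z]; intro e; have := h.iX 0 (by omega) (i + 1) (by omega) e; omega
    · rw [Z1s]; intro e; have := h.iX (j + 1 + k) (by omega) (i + 1) (by omega) e; omega

lemma frame2 (h : Poly n X Y) (c : Chord n k X Y) {V W : Finset (ℝ × ℝ)} {R : Set (ℝ × ℝ)}
    (hV : ∀ v ∈ V, ∃ i < k + 1, v.2 = Y2 k Y i)
    (H : C V W R) : C (V ∪ UU n k X Y) (W ∪ UU n k X Y) R := by
  have hk1 := c.k1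
  have hk2 := c.k2
  refine H.frame (G := fun q => ∀ i < n - (k + 1), q.2 ≠ Y (i + 1 + k)) (fun a b ha _ => ha) ?_ ?_
  · intro z hz hG
    obtain ⟨i, hi, rfl⟩ := mem_UU.1 hz
    exact hG i hi rfl
  · intro v hv i hi
    obtain ⟨j, hj, e⟩ := hV v hv
    rw [e, Y2l (by omega)]
    intro e; have := h.iY j (by omega) (i + 1 + k) (by omega) e; omega

theorem claim (n : ℕ) : ∀ X Y : ℕ → ℝ, Poly n X Y →
    C (V0 n X Y) (V1 n X Y) (RR n X Y) ∧ C (V1 n X Y) (V0 n X Y) (RR n X Y) := by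
  induction n using Nat.strong_induction_on with
  | _ n ih =>
  intro X Y h
  have hn := h.hn
  rcases Nat.lt_or_ge n 3 with h3 | h3
  · have : n = 2 := by omega
    subst this
    exact base h
  obtain ⟨X', Y', k, s, c⟩ := exists_chord h h3
  have hR : RR n X' Y' = RR n X Y := by
    ext q
    simp only [RR, Set.mem_ofPred_eq, s.bb, s.pp]
  suffices C (V0 n X' Y') (V1 n X' Y') (RR n X' Y') ∧ C (V1 n X' Y') (V0 n X' Y') (RR n X' Y') by
    rw [hR] at this
    rcases s.vv with ⟨h1, h2⟩ | ⟨h1, h2⟩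
    · rwa [h1, h2] at this
    · rw [h1, h2] at this; exact this.symm
  have h' := s.poly
  have hk1 := c.k1
  have hk2 := c.k2
  have Q1 := poly1 h' c
  have Q2 := poly2 h' c
  obtain ⟨a1, a2⟩ := ih (n - k) (by omega) _ _ Q1
  obtain ⟨b1, b2⟩ := ih (k + 1) (by omega) _ _ Q2
  have A1 := frame1 h' c (fun v hv => by
    obtain ⟨i, hi, rfl⟩ := mem_V0.1 hv
    exact ⟨i, hi, rfl⟩) a1
  have A2 := frame1 h' c (fun v hv => by
    obtain ⟨i, hi, rfl⟩ := mem_V1.1 hv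
    exact Q1.exX hi) a2
  have B1 := frame2 h' c (fun v hv => by
    obtain ⟨i, hi, rfl⟩ := mem_V0.1 hv
    exact ⟨i, hi, rfl⟩) b1
  have B2 := frame2 h' c (fun v hv => by
    obtain ⟨i, hi, rfl⟩ := mem_V1.1 hv
    exact ⟨i, hi, rfl⟩) b2
  rw [← split0 c, split_mid c] at A1
  rw [← split0 c, split_mid c] at A2
  rw [← split1 c] at B1 B2
  constructor
  · exact A1.concat B1 (RR_union h' c).ge (RR_inter h' c) (RR_vol h' c)
  · refine B2.concat A2 ?_ ?_ ?_
    · rw [Set.union_comm]; exact (RR_union h' c).ge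
    · rw [Set.inter_comm]; exact RR_inter h' c
    · rw [add_comm]; exact RR_vol h' c

end RP


namespace RP

open Finset

lemma Tr.toFin {V W : Finset (ℝ × ℝ)} {L : List ((ℝ × ℝ) × (ℝ × ℝ))} (h : Tr V L W) :
    ∃ F : Fin (L.length + 1) → Finset (ℝ × ℝ), F 0 = V ∧ F (Fin.last _) = W ∧
      ∀ j : Fin L.length, (L.get j).1 ∈ F j.castSucc ∧ (L.get j).2 ∈ F j.castSucc ∧
        (L.get j).1 ≠ (L.get j).2 ∧ F j.succ = step (F j.castSucc) (L.get j).1 (L.get j).2 := by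
  induction L generalizing V with
  | nil => exact ⟨fun _ => V, rfl, h, fun j => j.elim0⟩
  | cons p L ih =>
    obtain ⟨h1, h2, h3, h4⟩ := h
    obtain ⟨F, f1, f2, f3⟩ := ih h4
    refine ⟨Fin.cons V F, rfl, f2, ?_⟩
    intro j
    refine Fin.cases ?_ (fun j => ?_) j
    · refine ⟨h1, h2, h3, ?_⟩
      exact f1
    · exact f3 j

lemma seg_h (a b c : ℝ) : segment ℝ (a, c) (b, c) = {q : ℝ × ℝ | q.2 = c ∧ q.1 ∈ Set.uIcc a b} := by
  rw [← Prod.image_mk_segment_left, segment_eq_uIcc]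
  ext ⟨x, y⟩
  simp only [Set.mem_image, Prod.mk.injEq, Set.mem_ofPred_eq]
  constructor
  · rintro ⟨z, hz, rfl, rfl⟩; exact ⟨rfl, hz⟩
  · rintro ⟨rfl, hz⟩; exact ⟨x, hz, rfl, rfl⟩

lemma seg_v (a b c : ℝ) : segment ℝ (c, a) (c, b) = {q : ℝ × ℝ | q.1 = c ∧ q.2 ∈ Set.uIcc a b} := by
  rw [← Prod.image_mk_segment_right, segment_eq_uIcc]
  ext ⟨x, y⟩
  simp only [Set.mem_image, Prod.mk.injEq, Set.mem_ofPred_eq]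
  constructor
  · rintro ⟨z, hz, rfl, rfl⟩; exact ⟨rfl, hz⟩
  · rintro ⟨rfl, hz⟩; exact ⟨y, hz, rfl, rfl⟩

theorem extract (n : ℕ) (v : Fin (2 * n) → ℝ × ℝ) (hQ : IsSimpleRectPolygon n v) :
    ∃ X Y : ℕ → ℝ, Poly n X Y ∧ BB n X Y = polyBoundary v ∧
      V0 n X Y = (Finset.univ.filter fun i : Fin (2 * n) => (i : ℕ) % 2 = 0).image v ∧
      V1 n X Y = (Finset.univ.filter fun i : Fin (2 * n) => (i : ℕ) % 2 = 1).image v := by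
  obtain ⟨hn, hH, hV, iX, iY, -, hd, -⟩ := hQ
  have hm : 0 < 2 * n := by omega
  set W : ℕ → ℝ × ℝ := fun i => v ⟨i % (2 * n), Nat.mod_lt _ hm⟩ with hW
  have Wper : ∀ i, W (i + 2 * n) = W i := fun i => by simp [hW]
  have Wlt : ∀ i (hi : i < 2 * n), W i = v ⟨i, hi⟩ := fun i hi => by
    simp only [hW]; congr 2; exact Nat.mod_eq_of_lt hi
  have nx : ∀ i, nextIdx (⟨i % (2 * n), Nat.mod_lt _ hm⟩ : Fin (2 * n)) =
      ⟨(i + 1) % (2 * n), Nat.mod_lt _ hm⟩ := fun i => by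
    unfold nextIdx; ext; simp
  have nxlt : ∀ i (hi : i < 2 * n), nextIdx (⟨i, hi⟩ : Fin (2 * n)) =
      ⟨(i + 1) % (2 * n), Nat.mod_lt _ hm⟩ := fun i hi => by
    unfold nextIdx; ext; simp
  have Wn : ∀ i (hi : i < 2 * n), v (nextIdx ⟨i, hi⟩) = W (i + 1) := fun i hi => by
    rw [nxlt]
  have mod2 : ∀ i, i % (2 * n) % 2 = i % 2 := fun i => Nat.mod_mul_right_mod i 2 n
  have eH : ∀ i, (W (2 * i + 1)).2 = (W (2 * i)).2 ∧ (W (2 * i + 1)).1 ≠ (W (2 * i)).1 := by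
    intro i
    have := hH ⟨(2 * i) % (2 * n), Nat.mod_lt _ hm⟩ (by simp only; rw [mod2]; omega)
    rwa [nx] at this
  have eV : ∀ i, (W (2 * i + 2)).1 = (W (2 * i + 1)).1 ∧ (W (2 * i + 2)).2 ≠ (W (2 * i + 1)).2 := by
    intro i
    have := hV ⟨(2 * i + 1) % (2 * n), Nat.mod_lt _ hm⟩ (by simp only; rw [mod2]; omega)
    rwa [nx] at this
  set X : ℕ → ℝ := fun i => (W (2 * i)).1 with hX
  set Y : ℕ → ℝ := fun i => (W (2 * i)).2 with hY
  have We : ∀ i, W (2 * i) = (X i, Y i) := fun i => rfl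
  have Wo : ∀ i, W (2 * i + 1) = (X (i + 1), Y i) := fun i =>
    Prod.ext (eV i).1.symm (eH i).1
  have We2 : ∀ i, W (2 * i + 1 + 1) = (X (i + 1), Y (i + 1)) := fun i => rfl
  have hn2 : 2 ≤ n := by
    by_contra h0
    have : n = 1 := by omega
    subst this
    have h1 := (eH 0).2
    have h2 := (eV 0).1
    have h3 := Wper 0
    simp only [Nat.mul_zero, Nat.zero_add, Nat.mul_one] at h1 h2 h3
    rw [h3] at h2
    exact h1 h2.symm
  have cX : X n = X 0 := by
    have := Wper 0
    simp only [hX, Nat.mul_zero]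
    rw [Nat.zero_add] at this
    rw [this]
  have cY : Y n = Y 0 := by
    have := Wper 0
    simp only [hY, Nat.mul_zero]
    rw [Nat.zero_add] at this
    rw [this]
  have segH : ∀ i (hi : 2 * i < 2 * n),
      segment ℝ (v ⟨2 * i, hi⟩) (v (nextIdx ⟨2 * i, hi⟩)) = HE X Y i := by
    intro i hi
    rw [Wn, ← Wlt, We, Wo, seg_h]; rfl
  have segV : ∀ i (hi : 2 * i + 1 < 2 * n),
      segment ℝ (v ⟨2 * i + 1, hi⟩) (v (nextIdx ⟨2 * i + 1, hi⟩)) = VE X Y i := by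
    intro i hi
    rw [Wn, ← Wlt, We2, Wo, seg_v]; rfl
  refine ⟨X, Y, ⟨hn2, cX, cY, ?_, ?_, ?_⟩, ?_, ?_, ?_⟩
  · have key : ∀ i < n, ∃ t, ∃ ht : t < 2 * n, t % 2 = 1 ∧ (v ⟨t, ht⟩).1 = X i ∧
        (t + 1 = 2 * i ∨ (i = 0 ∧ t + 1 = 2 * n)) := by
      intro i hi
      rcases i with _ | i
      · refine ⟨2 * (n - 1) + 1, by omega, by omega, ?_, Or.inr ⟨rfl, by omega⟩⟩
        rw [← Wlt, Wo, Nat.sub_add_cancel (by omega)]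
        exact cX
      · refine ⟨2 * i + 1, by omega, by omega, ?_, Or.inl (by omega)⟩
        rw [← Wlt, Wo]
    intro i hi j hj e
    obtain ⟨t, ht, t2, te, tq⟩ := key i hi
    obtain ⟨u, hu, u2, ue, uq⟩ := key j hj
    have := iX ⟨t, ht⟩ ⟨u, hu⟩ t2 u2 (by rw [te, ue, e])
    rw [Fin.mk.injEq] at this
    omega
  · intro i hi j hj e
    have := iY ⟨2 * i, by omega⟩ ⟨2 * j, by omega⟩ (by simp) (by simp)
      (by rw [← Wlt, ← Wlt]; exact e)
    rw [Fin.mk.injEq] at this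
    omega
  · intro i hi j hj h1 h2
    by_cases c1 : i = j
    · right; rw [c1]
    by_cases c2 : (2 * j + 1 + 1) % (2 * n) = 2 * i
    · left
      have : W (2 * j + 1 + 1) = W (2 * i) := by
        simp only [hW, c2]
        congr 2
        exact (Nat.mod_eq_of_lt (by omega)).symm
      rw [We2, We] at this
      exact (Prod.ext_iff.1 this).1
    exfalso
    have h3 := hd ⟨2 * i, by omega⟩ ⟨2 * j + 1, by omega⟩
      (by rw [Ne, Fin.mk.injEq]; omega)
      (by rw [nxlt, Ne, Fin.mk.injEq, Nat.mod_eq_of_lt (by omega)]; omega)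
      (by rw [nxlt, Ne, Fin.mk.injEq]; exact c2)
    rw [segH, segV] at h3
    have h4 : (X (j + 1), Y i) ∈ HE X Y i ∩ VE X Y j := ⟨⟨rfl, h1⟩, ⟨rfl, h2⟩⟩
    rw [h3] at h4
    exact h4
  · ext q
    simp only [polyBoundary, Set.mem_iUnion]
    constructor
    · rintro ⟨i, hi, h1 | h1⟩
      · refine ⟨⟨2 * i, by omega⟩, ?_⟩
        rw [segH]; exact h1
      · refine ⟨⟨2 * i + 1, by omega⟩, ?_⟩
        rw [segV]; exact h1
    · rintro ⟨⟨t, ht⟩, h1⟩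
      obtain ⟨i, rfl | rfl⟩ := Nat.even_or_odd' t
      · rw [segH] at h1
        exact ⟨i, by omega, Or.inl h1⟩
      · rw [segV] at h1
        exact ⟨i, by omega, Or.inr h1⟩
  · ext q
    rw [mem_V0]
    simp only [Finset.mem_image, Finset.mem_filter, Finset.mem_univ, true_and]
    constructor
    · rintro ⟨i, hi, rfl⟩
      exact ⟨⟨2 * i, by omega⟩, by simp, by rw [← Wlt]⟩
    · rintro ⟨⟨t, ht⟩, h1, rfl⟩
      simp only at h1
      obtain ⟨i, rfl⟩ : ∃ i, t = 2 * i := ⟨t / 2, by omega⟩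
      exact ⟨i, by omega, by rw [← Wlt]⟩
  · ext q
    rw [mem_V1]
    simp only [Finset.mem_image, Finset.mem_filter, Finset.mem_univ, true_and]
    constructor
    · rintro ⟨i, hi, rfl⟩
      exact ⟨⟨2 * i + 1, by omega⟩, by simp only; omega, by rw [← Wlt, Wo]⟩
    · rintro ⟨⟨t, ht⟩, h1, rfl⟩
      simp only at h1
      obtain ⟨i, rfl⟩ : ∃ i, t = 2 * i + 1 := ⟨t / 2, by omega⟩
      exact ⟨i, by omega, by rw [← Wlt, Wo]⟩

end RP

open MeasureTheory

theorem stmt17 (n : ℕ) (v : Fin (2 * n) → ℝ × ℝ) (hQ : IsSimpleRectPolygon n v) :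
    ∃ (k : ℕ) (V : Fin (k + 1) → Finset (ℝ × ℝ)) (vv ww : Fin k → ℝ × ℝ),
      -- the sequence starts at `Ver₀(Q)` (the even vertices) and ends at
      -- `Ver₁(Q)` (the odd vertices),
      V 0 = (Finset.univ.filter fun i : Fin (2 * n) => (i : ℕ) % 2 = 0).image v ∧
      V (Fin.last k) =
        (Finset.univ.filter fun i : Fin (2 * n) => (i : ℕ) % 2 = 1).image v ∧
      -- each step is a rectangle transformation by `R j = R(vv j, ww j)`,
      (∀ j : Fin k, vv j ∈ V j.castSucc ∧ ww j ∈ V j.castSucc ∧ vv j ≠ ww j ∧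
        V j.succ = (V j.castSucc \ {vv j, ww j}) ∪
          {((ww j).1, (vv j).2), ((vv j).1, (ww j).2)}) ∧
      -- the rectangles are contained in the region bounded by `Q`,
      (∀ j : Fin k, rect (vv j) (ww j) ⊆ boundedRegion (polyBoundary v)) ∧
      -- have pairwise disjoint interiors,
      (∀ j j' : Fin k, j ≠ j' →
        interior (rect (vv j) (ww j)) ∩ interior (rect (vv j') (ww j')) = ∅) ∧
      -- and their areas add up to the area of the region bounded by `Q`.
      ∑ j : Fin k, volume (rect (vv j) (ww j))
        = volume (boundedRegion (polyBoundary v)) := by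
  obtain ⟨X, Y, h, hB, h0, h1⟩ := RP.extract n v hQ
  have hR : boundedRegion (polyBoundary v) = RP.RR n X Y := by
    rw [RP.jordan h, ← hB]; rfl
  obtain ⟨L, t1, t2, t3, t4⟩ := (RP.claim n X Y h).1
  obtain ⟨F, f1, f2, f3⟩ := t1.toFin
  refine ⟨L.length, F, fun j => (L.get j).1, fun j => (L.get j).2, ?_, ?_, ?_, ?_, ?_, ?_⟩
  · rw [f1, h0]
  · rw [f2, h1]
  · exact f3
  · intro j
    rw [hR]
    exact t2 _ (List.get_mem L j)
  · intro j j' hj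
    rw [List.pairwise_iff_get] at t3
    rcases lt_or_gt_of_ne hj with h2 | h2
    · exact t3 j j' h2
    · rw [Set.inter_comm]; exact t3 j' j h2
  · rw [hR, ← t4]
    exact Fin.sum_univ_fun_getElem L fun p => volume (rect p.1 p.2)
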